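/- Let C be a locally presentable category with a cofibrantly generated weak factorization system (L, R) such that ∅ → X lies in L for every object X, equipped with an exact cylinder I and a class An(I) of right I-anodyne extensions. For every object A of C there exists a unique model category structure on the slice category C/A whose cofibrations are the morphisms of C/A whose underlying morphisms in C lie in L and whose fibrant objects are exactly the objects (p : X → A) such that p is a right I-fibration. Dually, using a class An^l(I) of left I-anodyne extensions, there exists a unique model structure on C/A with the same cofibrations whose fibrant objects are exactly the left I-fibrations with target A. -/

import Mathlib

set_option linter.unusedSectionVars false

open CategoryTheory CategoryTheory.Limits

universe v u

namespace Paper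

variable {C : Type u} [Category.{v} C]

/-- The class of morphisms having the left lifting property against every morphism in `T`. -/
def llp (T : MorphismProperty C) : MorphismProperty C :=
  fun _ _ f => ∀ ⦃X Y : C⦄ (g : X ⟶ Y), T g → HasLiftingProperty f g

/-- The class of morphisms having the right lifting property against every morphism in `T`. -/
def rlp (T : MorphismProperty C) : MorphismProperty C :=
  fun _ _ g => ∀ ⦃A B : C⦄ (f : A ⟶ B), T f → HasLiftingProperty f g

/-- The morphism property associated to a set of arrows. -/
def ofArrows (S : Set (Arrow C)) : MorphismProperty C :=
  fun _ _ f => Arrow.mk f ∈ S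

/-- A (possibly large) category `J` is `κ`-filtered if every diagram in `J` indexed by a
small category of size `< κ` admits a cocone. -/
def IsCardinalFiltered (J : Cat.{v, v}) (κ : Cardinal.{v}) : Prop :=
  ∀ K : Cat.{v, v}, Cardinal.mk (Arrow K) < κ → ∀ F : K ⥤ J, Nonempty (Cocone F)

/-- An object `X` is `κ`-presentable if `Hom(X, -)` preserves colimits of `κ`-filtered
diagrams. -/
def IsPresentableObj (κ : Cardinal.{v}) (X : C) : Prop :=
  ∀ J : Cat.{v, v}, IsCardinalFiltered J κ →
    PreservesColimitsOfShape J (coyoneda.obj (Opposite.op X))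

/-- A category is locally presentable if it is cocomplete and there is a regular cardinal `κ`
and a small family of `κ`-presentable objects such that every object is a `κ`-filtered colimit
of objects of the family. -/
class LocallyPresentable (C : Type u) [Category.{v} C] extends HasColimits C : Prop where
  exists_presentable_generator :
    ∃ κ : Cardinal.{v}, κ.IsRegular ∧
      ∃ (ι : Type v) (G : ι → C), (∀ i, IsPresentableObj κ (G i)) ∧
        ∀ X : C, ∃ (J : Cat.{v, v}) (F : J ⥤ C) (c : Cocone F),
          IsCardinalFiltered J κ ∧ Nonempty (IsColimit c) ∧
          (∀ j : J, ∃ i, Nonempty (F.obj j ≅ G i)) ∧ Nonempty (c.pt ≅ X)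

/-- `(L, R)` is a cofibrantly generated weak factorization system such that every morphism
from the initial object is in `L`. -/
structure IsCofGenWFS [HasColimits C] (L R : MorphismProperty C) : Prop where
  exists_generating_set : ∃ S : Set (Arrow C), Small.{v} S ∧ L = llp (rlp (ofArrows S))
  rlp_eq : R = rlp L
  factorization : ∀ ⦃X Y : C⦄ (f : X ⟶ Y),
    ∃ (Z : C) (i : X ⟶ Z) (p : Z ⟶ Y), L i ∧ R p ∧ i ≫ p = f
  initial_mem : ∀ X : C, L (initial.to X)

/-- A functorial cylinder on `C`. -/
structure Cylinder (C : Type u) [Category.{v} C] where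
  I : C ⥤ C
  d0 : 𝟭 C ⟶ I
  d1 : 𝟭 C ⟶ I
  σ : I ⟶ 𝟭 C
  d0_σ : ∀ X : C, d0.app X ≫ σ.app X = 𝟙 X
  d1_σ : ∀ X : C, d1.app X ≫ σ.app X = 𝟙 X

namespace Cylinder

variable (E : Cylinder C)

lemma d0_naturality' {K M : C} (f : K ⟶ M) :
    f ≫ E.d0.app M = E.d0.app K ≫ E.I.map f := by
  simpa using E.d0.naturality f

lemma d1_naturality' {K M : C} (f : K ⟶ M) :
    f ≫ E.d1.app M = E.d1.app K ≫ E.I.map f := by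
  simpa using E.d1.naturality f

variable [HasColimits C]

/-- The canonical map `X ⊔ X ⟶ I(X)`. -/
noncomputable def ι (X : C) : X ⨿ X ⟶ E.I.obj X :=
  coprod.desc (E.d0.app X) (E.d1.app X)

lemma ι_naturality {K M : C} (f : K ⟶ M) :
    coprod.map f f ≫ E.ι M = E.ι K ≫ E.I.map f := by
  have h0 := E.d0.naturality f
  have h1 := E.d1.naturality f
  simp only [Functor.id_map] at h0 h1
  apply coprod.hom_ext <;> simp [ι, h0, h1]

/-- The pushout-corner map `∂I ⊠ f : (M ⊔ M) ⊔_{K ⊔ K} I(K) ⟶ I(M)`. -/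
noncomputable def boundaryBox {K M : C} (f : K ⟶ M) :
    pushout (coprod.map f f) (E.ι K) ⟶ E.I.obj M :=
  pushout.desc (E.ι M) (E.I.map f) (E.ι_naturality f)

/-- The pushout-corner map `∂0 ⊠ f : M ⊔_K I(K) ⟶ I(M)`. -/
noncomputable def box0 {K M : C} (f : K ⟶ M) :
    pushout f (E.d0.app K) ⟶ E.I.obj M :=
  pushout.desc (E.d0.app M) (E.I.map f) (E.d0_naturality' f)

/-- The pushout-corner map `∂1 ⊠ f : M ⊔_K I(K) ⟶ I(M)`. -/
noncomputable def box1 {K M : C} (f : K ⟶ M) :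
    pushout f (E.d1.app K) ⟶ E.I.obj M :=
  pushout.desc (E.d1.app M) (E.I.map f) (E.d1_naturality' f)

end Cylinder

/-- A cylinder is exact with respect to the class `L` if it preserves small colimits,
the maps `X ⊔ X ⟶ I(X)` are in `L`, and the pushout-corner maps of morphisms of `L` are
again in `L`. -/
structure IsExactCylinder [HasColimits C] (E : Cylinder C) (L : MorphismProperty C) : Prop where
  preservesColimits : PreservesColimits E.I
  ι_mem : ∀ X : C, L (E.ι X)
  boundaryBox_mem : ∀ ⦃K M : C⦄ (f : K ⟶ M), L f → L (E.boundaryBox f)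
  box0_mem : ∀ ⦃K M : C⦄ (f : K ⟶ M), L f → L (E.box0 f)
  box1_mem : ∀ ⦃K M : C⦄ (f : K ⟶ M), L f → L (E.box1 f)

/-- `An` is a class of right `I`-anodyne extensions. -/
structure IsRightAnodyneClass [HasColimits C] (E : Cylinder C) (L : MorphismProperty C)
    (An : MorphismProperty C) : Prop where
  le : An ≤ L
  exists_generating_set : ∃ Λ : Set (Arrow C), Small.{v} Λ ∧ ofArrows Λ ≤ L ∧
    An = llp (rlp (ofArrows Λ))
  box1_mem : ∀ ⦃K M : C⦄ (f : K ⟶ M), L f → An (E.box1 f)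
  boundaryBox_mem : ∀ ⦃K M : C⦄ (f : K ⟶ M), An f → An (E.boundaryBox f)

/-- `An` is a class of left `I`-anodyne extensions. -/
structure IsLeftAnodyneClass [HasColimits C] (E : Cylinder C) (L : MorphismProperty C)
    (An : MorphismProperty C) : Prop where
  le : An ≤ L
  exists_generating_set : ∃ Λ : Set (Arrow C), Small.{v} Λ ∧ ofArrows Λ ≤ L ∧
    An = llp (rlp (ofArrows Λ))
  box0_mem : ∀ ⦃K M : C⦄ (f : K ⟶ M), L f → An (E.box0 f)
  boundaryBox_mem : ∀ ⦃K M : C⦄ (f : K ⟶ M), An f → An (E.boundaryBox f)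

/-- A morphism is an `An`-fibration if it has the right lifting property against all
morphisms of `An`. -/
def IsFib (An : MorphismProperty C) {X Y : C} (p : X ⟶ Y) : Prop :=
  ∀ ⦃A B : C⦄ (f : A ⟶ B), An f → HasLiftingProperty f p

/-- An object `W` is `An`-fibrant if the map `W ⟶ *` has the right lifting property against
all morphisms of `An`, i.e. every morphism to `W` extends along every morphism of `An`. -/
def IsFibrantObj (An : MorphismProperty C) (W : C) : Prop :=
  ∀ ⦃A B : C⦄ (f : A ⟶ B), An f → ∀ a : A ⟶ W, ∃ b : B ⟶ W, f ≫ b = a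

namespace Cylinder

variable (E : Cylinder C)

/-- An `I`-homotopy from `f` to `g`. -/
def Homotopy {X Y : C} (f g : X ⟶ Y) : Prop :=
  ∃ h : E.I.obj X ⟶ Y, E.d0.app X ≫ h = f ∧ E.d1.app X ≫ h = g

/-- `[X, Y]_I`, the quotient of `Hom(X, Y)` by the equivalence relation generated by
`I`-homotopy. -/
def HoHom (X Y : C) : Type v :=
  Quot (fun f g : X ⟶ Y => E.Homotopy f g)

/-- Precomposition `f^* : [B, W]_I ⟶ [A, W]_I`. -/
def precompQ {A B : C} (f : A ⟶ B) (W : C) : E.HoHom B W → E.HoHom A W :=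
  Quot.lift (fun g => Quot.mk _ (f ≫ g)) (by
    rintro g g' ⟨h, h0, h1⟩
    apply Quot.sound
    refine ⟨E.I.map f ≫ h, ?_, ?_⟩
    · rw [← Category.assoc, ← E.d0_naturality' f, Category.assoc, h0]
    · rw [← Category.assoc, ← E.d1_naturality' f, Category.assoc, h1])

end Cylinder

/-- `f` is a weak equivalence if it induces bijections `[B, W]_I ≅ [A, W]_I` for all
fibrant `W`. -/
def IsWeakEq (E : Cylinder C) (An : MorphismProperty C) {A B : C} (f : A ⟶ B) : Prop :=
  ∀ W : C, IsFibrantObj An W → Function.Bijective (E.precompQ f W)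

/-- `f` is a retract of `f'`. -/
def IsRetractOf {X Y X' Y' : C} (f : X ⟶ Y) (f' : X' ⟶ Y') : Prop :=
  ∃ (i : X ⟶ X') (r : X' ⟶ X) (j : Y ⟶ Y') (s : Y' ⟶ Y),
    i ≫ r = 𝟙 X ∧ j ≫ s = 𝟙 Y ∧ i ≫ f' = f ≫ j ∧ f' ≫ s = r ≫ f

/-- A model structure on a category: the classes of weak equivalences, cofibrations and
fibrations, subject to the two-out-of-three, retract, lifting and factorization axioms. -/
structure ModelStructure (C : Type u) [Category.{v} C] where
  weq : MorphismProperty C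
  cof : MorphismProperty C
  fib : MorphismProperty C
  weq_id : ∀ X : C, weq (𝟙 X)
  weq_comp : ∀ ⦃X Y Z : C⦄ (f : X ⟶ Y) (g : Y ⟶ Z), weq f → weq g → weq (f ≫ g)
  weq_cancel_left : ∀ ⦃X Y Z : C⦄ (f : X ⟶ Y) (g : Y ⟶ Z), weq f → weq (f ≫ g) → weq g
  weq_cancel_right : ∀ ⦃X Y Z : C⦄ (f : X ⟶ Y) (g : Y ⟶ Z), weq g → weq (f ≫ g) → weq f
  weq_retract : ∀ ⦃X Y X' Y' : C⦄ (f : X ⟶ Y) (f' : X' ⟶ Y'),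
    IsRetractOf f f' → weq f' → weq f
  cof_retract : ∀ ⦃X Y X' Y' : C⦄ (f : X ⟶ Y) (f' : X' ⟶ Y'),
    IsRetractOf f f' → cof f' → cof f
  fib_retract : ∀ ⦃X Y X' Y' : C⦄ (f : X ⟶ Y) (f' : X' ⟶ Y'),
    IsRetractOf f f' → fib f' → fib f
  lift_trivCof_fib : ∀ ⦃A B X Y : C⦄ (i : A ⟶ B) (p : X ⟶ Y),
    cof i → weq i → fib p → HasLiftingProperty i p
  lift_cof_trivFib : ∀ ⦃A B X Y : C⦄ (i : A ⟶ B) (p : X ⟶ Y),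
    cof i → fib p → weq p → HasLiftingProperty i p
  fact_cof_trivFib : ∀ ⦃X Y : C⦄ (f : X ⟶ Y),
    ∃ (Z : C) (i : X ⟶ Z) (p : Z ⟶ Y), cof i ∧ fib p ∧ weq p ∧ i ≫ p = f
  fact_trivCof_fib : ∀ ⦃X Y : C⦄ (f : X ⟶ Y),
    ∃ (Z : C) (i : X ⟶ Z) (p : Z ⟶ Y), cof i ∧ weq i ∧ fib p ∧ i ≫ p = f

/-- An object `W` is fibrant for a model structure if every morphism to `W` extends along
every trivial cofibration, i.e. `W ⟶ *` has the right lifting property against trivial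
cofibrations. -/
def ModelStructure.Fibrant (M : ModelStructure C) (W : C) : Prop :=
  ∀ ⦃A B : C⦄ (i : A ⟶ B), M.cof i → M.weq i → ∀ a : A ⟶ W, ∃ b : B ⟶ W, i ≫ b = a


/-- The class of morphisms of the slice `C/A` whose underlying morphism lies in `L`. -/
def overProp (L : MorphismProperty C) (A : C) : MorphismProperty (Over A) :=
  fun _ _ f => L f.left

lemma isCardinalFiltered_iff {J : Type v} [SmallCategory J] {κ : Cardinal.{v}}
    [Fact κ.IsRegular] :
    IsCardinalFiltered (Cat.of J) κ ↔ CategoryTheory.IsCardinalFiltered J κ := by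
  constructor
  · intro h
    exact ⟨fun {A} _ F hA => h (Cat.of A) ((hasCardinalLT_iff_cardinal_mk_lt _ _).1 hA) F⟩
  · intro h K hK F
    exact h.nonempty_cocone F ((hasCardinalLT_iff_cardinal_mk_lt _ _).2 hK)

lemma IsPresentableObj.isCardinalPresentable {κ : Cardinal.{v}} [Fact κ.IsRegular] {X : C}
    (h : IsPresentableObj κ X) : IsCardinalPresentable X κ where
  preservesColimitOfShape J _ _ := h (Cat.of J) (isCardinalFiltered_iff.2 inferInstance)

lemma LocallyPresentable.exists_isCardinalLocallyPresentable [LocallyPresentable C] :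
    ∃ (κ : Cardinal.{v}) (_ : Fact κ.IsRegular), IsCardinalLocallyPresentable C κ := by
  obtain ⟨κ, hκ, ι, G, hG, h⟩ := LocallyPresentable.exists_presentable_generator (C := C)
  have : Fact κ.IsRegular := ⟨hκ⟩
  refine ⟨κ, this, ?_⟩
  let P : ObjectProperty C := ObjectProperty.ofObj G
  have hP : P.isoClosure.IsCardinalFilteredGenerator κ := {
    le_isCardinalPresentable := by
      rw [ObjectProperty.isoClosure_le_iff]
      rintro _ ⟨i⟩
      exact (hG i).isCardinalPresentable
    exists_colimitsOfShape := fun X => by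
      obtain ⟨J, F, c, hJ, ⟨hc⟩, hF, ⟨e⟩⟩ := h X
      refine ⟨J, inferInstance, isCardinalFiltered_iff.1 hJ, ?_⟩
      refine ObjectProperty.prop_of_iso _ e ⟨⟨⟨F, c.ι, hc⟩, fun j => ?_⟩⟩
      obtain ⟨i, ⟨e'⟩⟩ := hF j
      exact ⟨_, ⟨i⟩, ⟨e'⟩⟩ }
  have : HasCardinalFilteredGenerator C κ := hP.hasCardinalFilteredGenerator
  exact { }

section presentability

variable (κ : Cardinal.{v}) [Fact κ.IsRegular]

/-- An elementwise criterion for presentability. -/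
lemma isCardinalPresentable_of_forall {X : C}
    (h : ∀ (J : Type v) [SmallCategory J] [CategoryTheory.IsCardinalFiltered J κ]
      (F : J ⥤ C) (c : Cocone F) (_ : IsColimit c),
      (∀ f : X ⟶ c.pt, ∃ (j : J) (g : X ⟶ F.obj j), g ≫ c.ι.app j = f) ∧
      (∀ (j : J) (f g : X ⟶ F.obj j), f ≫ c.ι.app j = g ≫ c.ι.app j →
        ∃ (k : J) (a : j ⟶ k), f ≫ F.map a = g ≫ F.map a)) :
    IsCardinalPresentable X κ where
  preservesColimitOfShape J _ _ := ⟨fun {F} => ⟨fun {c} hc => by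
    have := isFiltered_of_isCardinalFiltered J κ
    obtain ⟨h₁, h₂⟩ := h J F c hc
    refine ⟨Types.FilteredColimit.isColimitOf' _ _ (fun f => ?_) (fun j f g hfg => h₂ j f g hfg)⟩
    obtain ⟨j, g, hg⟩ := h₁ f
    exact ⟨j, g, hg.symm⟩⟩⟩

section

variable {κ} {D : Type*} [Category.{v} D] (U : D ⥤ C) {J : Type v} [SmallCategory J]
  [CategoryTheory.IsCardinalFiltered J κ] [PreservesColimitsOfShape J U]
  {F : J ⥤ D} {c : Cocone F} (hc : IsColimit c) {X : C} (hX : IsCardinalPresentable X κ)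

include hc hX

lemma exists_hom_map_of_isColimit (f : X ⟶ U.obj c.pt) :
    ∃ (j : J) (g : X ⟶ U.obj (F.obj j)), g ≫ U.map (c.ι.app j) = f :=
  IsCardinalPresentable.exists_hom_of_isColimit κ (isColimitOfPreserves U hc) f

lemma exists_eq_map_of_isColimit {j : J} (f g : X ⟶ U.obj (F.obj j))
    (h : f ≫ U.map (c.ι.app j) = g ≫ U.map (c.ι.app j)) :
    ∃ (k : J) (a : j ⟶ k), f ≫ U.map (F.map a) = g ≫ U.map (F.map a) :=
  IsCardinalPresentable.exists_eq_of_isColimit' κ (isColimitOfPreserves U hc) f g h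

end

lemma isCardinalPresentable_overMk {A X : C} (p : X ⟶ A) [hX : IsCardinalPresentable X κ]
    [HasColimitsOfSize.{v, v} C] : IsCardinalPresentable (Over.mk p) κ := by
  refine isCardinalPresentable_of_forall κ fun J _ _ F c hc => ⟨fun f => ?_, fun j f g hfg => ?_⟩
  · obtain ⟨j, g, hg⟩ : ∃ (j : J) (g : X ⟶ (F.obj j).left), g ≫ (c.ι.app j).left = f.left :=
      exists_hom_map_of_isColimit (Over.forget A) hc hX _
    refine ⟨j, Over.homMk g ?_, Over.OverMorphism.ext hg⟩
    simpa [← hg] using Over.w f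
  · obtain ⟨k, a, h⟩ : ∃ (k : J) (a : j ⟶ k), f.left ≫ (F.map a).left = g.left ≫ (F.map a).left :=
      exists_eq_map_of_isColimit (Over.forget A) hc hX _ _ (congr_arg CommaMorphism.left hfg)
    exact ⟨k, a, Over.OverMorphism.ext h⟩

lemma isCardinalLocallyPresentable_over [IsCardinalLocallyPresentable C κ] (A : C) :
    IsCardinalLocallyPresentable (Over A) κ := by
  obtain ⟨P, _, hP, hP'⟩ :=
    (IsCardinalLocallyPresentable.iff_exists_isStrongGenerator C κ).1 inferInstance
  have : HasColimitsOfSize.{v, v} (Over A) := inferInstance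
  rw [IsCardinalLocallyPresentable.iff_exists_isStrongGenerator]
  let ι := Σ G : Subtype P, (G.1 ⟶ A)
  have : Small.{v} (Subtype P) := ‹ObjectProperty.Small.{v} P›
  have : Small.{v} ι := inferInstance
  refine ⟨ObjectProperty.ofObj fun x : ι => Over.mk x.2, inferInstance, ?_, ?_⟩
  · rw [ObjectProperty.isStrongGenerator_iff]
    constructor
    · intro X Y f g h
      ext
      refine hP.isSeparating _ _ fun G hG a => ?_
      have := h _ (ObjectProperty.ofObj_apply _ (⟨⟨G, hG⟩, a ≫ X.hom⟩ : ι)) (Over.homMk a)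
      exact congr_arg CommaMorphism.left this
    · intro X Y i _ h
      have : IsIso i.left := by
        refine hP.isIso_of_mono _ fun G hG a => ?_
        obtain ⟨b, hb⟩ := h _ (ObjectProperty.ofObj_apply _ (⟨⟨G, hG⟩, a ≫ Y.hom⟩ : ι))
          (Over.homMk a)
        exact ⟨b.left, congr_arg CommaMorphism.left hb⟩
      have : IsIso ((Over.forget A).map i) := this
      exact isIso_of_reflects_iso i (Over.forget A)
  · rintro _ ⟨G, a⟩
    have : IsCardinalPresentable G.1 κ := hP' _ G.2
    exact isCardinalPresentable_overMk κ a

lemma isCardinalPresentable_arrowMk {K M : C} (k : K ⟶ M) [hK : IsCardinalPresentable K κ]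
    [hM : IsCardinalPresentable M κ] [HasColimitsOfSize.{v, v} C] :
    IsCardinalPresentable (Arrow.mk k) κ := by
  refine isCardinalPresentable_of_forall κ fun J _ _ F c hc => ?_
  have := isFiltered_of_isCardinalFiltered J κ
  refine ⟨fun f => ?_, fun j f g hfg => ?_⟩
  · obtain ⟨j₁, a, ha⟩ : ∃ (j : J) (a : K ⟶ (F.obj j).left), a ≫ (c.ι.app j).left = f.left :=
      exists_hom_map_of_isColimit Arrow.leftFunc hc hK _
    obtain ⟨j₂, b, hb⟩ : ∃ (j : J) (b : M ⟶ (F.obj j).right), b ≫ (c.ι.app j).right = f.right :=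
      exists_hom_map_of_isColimit Arrow.rightFunc hc hM _
    let j := IsFiltered.max j₁ j₂
    let u : j₁ ⟶ j := IsFiltered.leftToMax j₁ j₂
    let w : j₂ ⟶ j := IsFiltered.rightToMax j₁ j₂
    obtain ⟨a', ha'⟩ : ∃ (a' : K ⟶ (F.obj j).left), a' ≫ (c.ι.app j).left = f.left :=
      ⟨a ≫ (F.map u).left, by rw [Category.assoc, ← Arrow.comp_left, c.w, ha]⟩
    obtain ⟨b', hb'⟩ : ∃ (b' : M ⟶ (F.obj j).right), b' ≫ (c.ι.app j).right = f.right :=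
      ⟨b ≫ (F.map w).right, by rw [Category.assoc, ← Arrow.comp_right, c.w, hb]⟩
    obtain ⟨l, t, ht⟩ : ∃ (l : J) (t : j ⟶ l), (a' ≫ (F.obj j).hom) ≫ (F.map t).right =
        (k ≫ b') ≫ (F.map t).right := by
      refine exists_eq_map_of_isColimit Arrow.rightFunc hc hK _ _ ?_
      have h₁ : (c.ι.app j).left ≫ c.pt.hom = (F.obj j).hom ≫ (c.ι.app j).right :=
        Arrow.w (c.ι.app j)
      have h₂ : f.left ≫ c.pt.hom = k ≫ f.right := Arrow.w f
      change (a' ≫ (F.obj j).hom) ≫ (c.ι.app j).right = (k ≫ b') ≫ (c.ι.app j).right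
      rw [Category.assoc, ← h₁, reassoc_of% ha', h₂, Category.assoc, hb']
    have h₃ : (F.map t).left ≫ (F.obj l).hom = (F.obj j).hom ≫ (F.map t).right :=
      Arrow.w (F.map t)
    refine ⟨l, Arrow.homMk (a' ≫ (F.map t).left) (b' ≫ (F.map t).right) ?_, ?_⟩
    · simp only [Category.assoc] at ht
      simp only [Category.assoc, h₃, ht, Arrow.mk_hom]
    · ext
      · simp only [Arrow.comp_left, Arrow.homMk_left, Category.assoc]
        rw [← Arrow.comp_left, c.w, ha']
      · simp only [Arrow.comp_right, Arrow.homMk_right, Category.assoc]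
        rw [← Arrow.comp_right, c.w, hb']
  · obtain ⟨k₁, a, ha⟩ : ∃ (l : J) (a : j ⟶ l), f.left ≫ (F.map a).left = g.left ≫ (F.map a).left :=
      exists_eq_map_of_isColimit Arrow.leftFunc hc hK _ _ (congr_arg CommaMorphism.left hfg)
    obtain ⟨k₂, b, hb⟩ : ∃ (l : J) (a : j ⟶ l),
        f.right ≫ (F.map a).right = g.right ≫ (F.map a).right :=
      exists_eq_map_of_isColimit Arrow.rightFunc hc hM _ _ (congr_arg CommaMorphism.right hfg)
    obtain ⟨l, u, w, huw⟩ := IsFiltered.span a b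
    refine ⟨l, a ≫ u, ?_⟩
    ext
    · simp only [Functor.map_comp, Arrow.comp_left, reassoc_of% ha]
    · rw [huw]
      simp only [Functor.map_comp, Arrow.comp_right, reassoc_of% hb]

lemma isCardinalLocallyPresentable_arrow [IsCardinalLocallyPresentable C κ] :
    IsCardinalLocallyPresentable (Arrow C) κ := by
  obtain ⟨P, _, hP, hP'⟩ :=
    (IsCardinalLocallyPresentable.iff_exists_isStrongGenerator C κ).1 inferInstance
  have : HasColimitsOfSize.{v, v} (Arrow C) := ⟨fun _ _ => inferInstance⟩
  rw [IsCardinalLocallyPresentable.iff_exists_isStrongGenerator]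
  let ι := Subtype P
  have : Small.{v} ι := ‹ObjectProperty.Small.{v} P›
  let G : ι ⊕ ι → Arrow C :=
    Sum.elim (fun x => Arrow.mk (𝟙 x.1)) (fun x => Arrow.mk (initial.to x.1))
  refine ⟨ObjectProperty.ofObj G, inferInstance, ?_, ?_⟩
  · rw [ObjectProperty.isStrongGenerator_iff]
    constructor
    · intro X Y f g h
      ext
      · refine hP.isSeparating _ _ fun Z hZ a => ?_
        have := h _ (ObjectProperty.ofObj_apply G (Sum.inl ⟨Z, hZ⟩))
          (Arrow.homMk a (a ≫ X.hom) (by simp [G]))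
        exact congr_arg CommaMorphism.left this
      · refine hP.isSeparating _ _ fun Z hZ a => ?_
        have := h _ (ObjectProperty.ofObj_apply G (Sum.inr ⟨Z, hZ⟩))
          (Arrow.homMk (initial.to _) a (by simp [G]))
        exact congr_arg CommaMorphism.right this
    · intro X Y i _ h
      have hl : Mono i.left := inferInstance
      have hr : Mono i.right := by
        constructor
        intro Z a b hab
        let a' : Arrow.mk (initial.to Z) ⟶ X := Arrow.homMk (initial.to _) a (by simp)
        let b' : Arrow.mk (initial.to Z) ⟶ X := Arrow.homMk (initial.to _) b (by simp)
        have : a' = b' := by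
          rw [← cancel_mono i]
          ext
          · exact initial.hom_ext _ _
          · exact hab
        exact congr_arg CommaMorphism.right this
      have : IsIso i.left := by
        refine hP.isIso_of_mono _ fun Z hZ a => ?_
        obtain ⟨b, hb⟩ := h _ (ObjectProperty.ofObj_apply G (Sum.inl ⟨Z, hZ⟩))
          (Arrow.homMk a (a ≫ Y.hom) (by simp [G]))
        exact ⟨b.left, congr_arg CommaMorphism.left hb⟩
      have : IsIso i.right := by
        refine hP.isIso_of_mono _ fun Z hZ a => ?_
        obtain ⟨b, hb⟩ := h _ (ObjectProperty.ofObj_apply G (Sum.inr ⟨Z, hZ⟩))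
          (Arrow.homMk (initial.to _) a (by simp [G]))
        exact ⟨b.right, congr_arg CommaMorphism.right hb⟩
      exact Arrow.isIso_of_isIso_left_of_isIso_right i
  · rintro _ ⟨G | G⟩
    · have : IsCardinalPresentable G.1 κ := hP' _ G.2
      exact isCardinalPresentable_arrowMk κ (𝟙 G.1)
    · have : IsCardinalPresentable G.1 κ := hP' _ G.2
      have : IsCardinalPresentable (⊥_ C) κ := by
        refine isCardinalPresentable_of_forall κ fun J _ _ F c hc => ?_
        have := isFiltered_of_isCardinalFiltered J κ
        exact ⟨fun f => ⟨IsFiltered.nonempty.some, initial.to _, Subsingleton.elim _ _⟩,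
          fun j f g _ => ⟨j, 𝟙 j, by rw [Subsingleton.elim f g]⟩⟩
      exact isCardinalPresentable_arrowMk κ (initial.to G.1)

end presentability

lemma arrow_isColimit_of_left_right {J : Type*} [Category* J] {F : J ⥤ Arrow C} {c : Cocone F}
    (hl : Nonempty (IsColimit (Arrow.leftFunc.mapCocone c)))
    (hr : Nonempty (IsColimit (Arrow.rightFunc.mapCocone c))) : Nonempty (IsColimit c) :=
  ⟨Comma.fstSndJointlyReflectColimit hl.some hr.some⟩

section cells

open SmallObject

variable {ι : Type*} {A B : ι → C} (f : ∀ i, A i ⟶ B i) [HasPushouts C]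
  [∀ {X S : C} (πX : X ⟶ S), HasColimitsOfShape (Discrete (FunctorObjIndex f πX)) C]

/-- The inclusion of `X` in the first step of the small object argument. -/
noncomputable def cellι (X : Arrow C) : X.left ⟶ ((functor f).obj X).left :=
  ιFunctorObj f X.hom

/-- The cell of the small object construction given by a morphism of arrows. -/
noncomputable def cell {X : Arrow C} {i : ι} (φ : Arrow.mk (f i) ⟶ X) :
    B i ⟶ ((functor f).obj X).left :=
  Sigma.ι (functorObjTgtFamily f X.hom)
    (FunctorObjIndex.mk i φ.left φ.right (Arrow.w φ)) ≫ ρFunctorObj f X.hom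

lemma comp_cell {X : Arrow C} {i : ι} (φ : Arrow.mk (f i) ⟶ X) :
    f i ≫ cell f φ = φ.left ≫ cellι f X :=
  FunctorObjIndex.comm f X.hom (FunctorObjIndex.mk i φ.left φ.right (Arrow.w φ))

lemma cellι_naturality {X Y : Arrow C} (τ : X ⟶ Y) :
    cellι f X ≫ ((functor f).map τ).left = τ.left ≫ cellι f Y :=
  ιFunctorObj_naturality f (πX := X.hom) (πY := Y.hom) τ

lemma cell_map {X Y : Arrow C} {i : ι} (φ : Arrow.mk (f i) ⟶ X) (τ : X ⟶ Y) :
    cell f φ ≫ ((functor f).map τ).left = cell f (φ ≫ τ) := by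
  have h := ι_functorMapTgt_assoc f (πX := X.hom) (πY := Y.hom) τ i φ.left φ.right
    (Arrow.w φ) _ rfl _ rfl (ρFunctorObj f Y.hom)
  refine (Category.assoc _ _ _).trans (Eq.trans ?_ h)
  exact congr_arg _ (pushout.inr_desc _ _ _)

lemma cell_hom_ext {X : Arrow C} {Z : C} {a b : ((functor f).obj X).left ⟶ Z}
    (h : cellι f X ≫ a = cellι f X ≫ b)
    (h' : ∀ (i : ι) (φ : Arrow.mk (f i) ⟶ X), cell f φ ≫ a = cell f φ ≫ b) : a = b := by
  refine pushout.hom_ext h ?_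
  refine Sigma.hom_ext _ _ ?_
  rintro ⟨i, t, b, w⟩
  exact (Category.assoc _ _ _).symm.trans ((h' i (Arrow.homMk t b w)).trans (Category.assoc _ _ _))

lemma exists_cell_desc {X : Arrow C} {Z : C} (a : X.left ⟶ Z)
    (b : ∀ (i : ι) (_ : Arrow.mk (f i) ⟶ X), B i ⟶ Z)
    (h : ∀ (i : ι) (φ : Arrow.mk (f i) ⟶ X), f i ≫ b i φ = φ.left ≫ a) :
    ∃ d : ((functor f).obj X).left ⟶ Z, cellι f X ≫ d = a ∧
      ∀ (i : ι) (φ : Arrow.mk (f i) ⟶ X), cell f φ ≫ d = b i φ := by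
  let d : functorObj f X.hom ⟶ Z := pushout.desc a
    (Sigma.desc fun x => b x.i (Arrow.homMk x.t x.b x.w)) (by
      refine Sigma.hom_ext _ _ ?_
      rintro ⟨i, t, b', w⟩
      simpa using (h i (Arrow.homMk t b' w)).symm)
  refine ⟨d, pushout.inl_desc _ _ _, fun i φ => ?_⟩
  have : ρFunctorObj f X.hom ≫ d = _ := pushout.inr_desc _ _ _
  exact (Category.assoc _ _ _).trans ((congr_arg _ this).trans (Sigma.ι_desc _ _))

end cells

section

open SmallObject

variable {ι : Type*} {A B : ι → C} (f : ∀ i, A i ⟶ B i) [HasColimitsOfSize.{v, v} C]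
  [∀ {X S : C} (πX : X ⟶ S), HasColimitsOfShape (Discrete (FunctorObjIndex f πX)) C]
  (κ : Cardinal.{v}) [Fact κ.IsRegular]

section

variable {κ} {J : Type v} [SmallCategory J] [CategoryTheory.IsCardinalFiltered J κ]
  {F : J ⥤ Arrow C} {c : Cocone F} (hc : IsColimit c)

include hc

lemma exists_left_desc_of_isColimit {Z : C} (t : ∀ j, (F.obj j).left ⟶ Z)
    (ht : ∀ {j k : J} (a : j ⟶ k), (F.map a).left ≫ t k = t j) :
    ∃ d : c.pt.left ⟶ Z, ∀ j, (c.ι.app j).left ≫ d = t j := by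
  let s : Cocone (F ⋙ Arrow.leftFunc) :=
    { pt := Z, ι := { app := t, naturality := fun j k a => (ht a).trans (Category.comp_id _).symm } }
  exact ⟨(isColimitOfPreserves Arrow.leftFunc hc).desc s,
    (isColimitOfPreserves Arrow.leftFunc hc).fac s⟩

lemma left_hom_ext_of_isColimit {Z : C} {a b : c.pt.left ⟶ Z}
    (h : ∀ j, (c.ι.app j).left ≫ a = (c.ι.app j).left ≫ b) : a = b :=
  (isColimitOfPreserves Arrow.leftFunc hc).hom_ext h

variable (hf : ∀ i, IsCardinalPresentable (Arrow.mk (f i)) κ)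

include hf

lemma cell_hom_ext_of_isColimit {Z : C} {a b : ((functor f).obj c.pt).left ⟶ Z}
    (h : ∀ j, ((functor f).map (c.ι.app j)).left ≫ a =
      ((functor f).map (c.ι.app j)).left ≫ b) : a = b := by
  refine cell_hom_ext f (left_hom_ext_of_isColimit hc fun j => ?_) fun i φ => ?_
  · have hn : cellι f (F.obj j) ≫ ((functor f).map (c.ι.app j)).left =
      (c.ι.app j).left ≫ cellι f c.pt := cellι_naturality f (Y := c.pt) (c.ι.app j)
    exact (Category.assoc _ _ _).symm.trans (((congr_arg (· ≫ a) hn).symm.trans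
      ((Category.assoc _ _ _).trans ((congr_arg (_ ≫ ·) (h j)).trans
        (Category.assoc _ _ _).symm))).trans
      ((congr_arg (· ≫ b) hn).trans (Category.assoc _ _ _)))
  · obtain ⟨j, ψ, rfl⟩ := IsCardinalPresentable.exists_hom_of_isColimit κ hc φ
    rw [← cell_map, Category.assoc, Category.assoc, h]

lemma exists_cell_desc_of_isColimit {Z : C} (t : ∀ j, ((functor f).obj (F.obj j)).left ⟶ Z)
    (ht : ∀ {j k : J} (a : j ⟶ k), ((functor f).map (F.map a)).left ≫ t k = t j) :
    ∃ d : ((functor f).obj c.pt).left ⟶ Z,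
      ∀ j, ((functor f).map (c.ι.app j)).left ≫ d = t j := by
  have := isFiltered_of_isCardinalFiltered J κ
  obtain ⟨a, ha⟩ := exists_left_desc_of_isColimit hc (fun j => cellι f (F.obj j) ≫ t j)
    (fun {j k} a => by rw [← Category.assoc, ← cellι_naturality, Category.assoc, ht])
  have hb (i : ι) (φ : Arrow.mk (f i) ⟶ c.pt) : ∃ b : B i ⟶ Z,
      ∀ (j : J) (ψ : Arrow.mk (f i) ⟶ F.obj j), ψ ≫ c.ι.app j = φ → cell f ψ ≫ t j = b := by
    obtain ⟨j, ψ, hψ⟩ := IsCardinalPresentable.exists_hom_of_isColimit κ hc φ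
    refine ⟨cell f ψ ≫ t j, fun j' ψ' hψ' => ?_⟩
    obtain ⟨k, u, w, h⟩ := IsCardinalPresentable.exists_eq_of_isColimit κ hc ψ' ψ
      (hψ'.trans hψ.symm)
    rw [← ht u, ← ht w, ← Category.assoc, cell_map, ← Category.assoc, cell_map, h]
  choose b hb using hb
  obtain ⟨d, hd₁, hd₂⟩ := exists_cell_desc f a b (fun i φ => by
    obtain ⟨j, ψ, hψ⟩ := IsCardinalPresentable.exists_hom_of_isColimit κ hc φ
    rw [← hb i φ j ψ hψ, ← Category.assoc, comp_cell, ← hψ, Arrow.comp_left,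
      Category.assoc, Category.assoc, ha])
  refine ⟨d, fun j => cell_hom_ext f ?_ fun i φ => ?_⟩
  · have hn : cellι f (F.obj j) ≫ ((functor f).map (c.ι.app j)).left =
      (c.ι.app j).left ≫ cellι f c.pt := cellι_naturality f (Y := c.pt) (c.ι.app j)
    exact (Category.assoc _ _ _).symm.trans ((congr_arg (· ≫ d) hn).trans
      ((Category.assoc _ _ _).trans ((congr_arg (_ ≫ ·) hd₁).trans (ha j))))
  · rw [← Category.assoc, cell_map, hd₂, hb _ _ _ _ rfl]

end

/-- One step of the small object argument is an accessible functor. -/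
lemma isCardinalAccessible_smallObject_functor
    (hf : ∀ i, IsCardinalPresentable (Arrow.mk (f i)) κ) :
    (functor f).IsCardinalAccessible κ where
  preservesColimitOfShape J _ _ := ⟨fun {F} => ⟨fun {c} hc => by
    have hr := isColimitOfPreserves Arrow.rightFunc hc
    refine arrow_isColimit_of_left_right ⟨?_⟩ ⟨hr⟩
    choose d hd using fun (s : Cocone (F ⋙ functor f ⋙ Arrow.leftFunc)) =>
      exists_cell_desc_of_isColimit f hc hf s.ι.app s.w
    exact { desc := d
            fac := hd
            uniq := fun s m hm => cell_hom_ext_of_isColimit f hc hf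
              fun j => (hm j).trans (hd s j).symm }⟩⟩

end

section

variable {D : Type*} [Category* D] (κ : Cardinal.{v}) [Fact κ.IsRegular]

lemma isCardinalAccessible_of_isColimit [HasColimitsOfSize.{v, v} C] {K : Type v}
    [SmallCategory K] {F : K ⥤ D ⥤ C} {c : Cocone F} (hc : IsColimit c)
    (hF : ∀ k, (F.obj k).IsCardinalAccessible κ) : c.pt.IsCardinalAccessible κ where
  preservesColimitOfShape J _ _ := by
    have (k : K) : PreservesColimitsOfShape J (F.obj k) :=
      (F.obj k).preservesColimitsOfShape_of_isCardinalAccessible κ J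
    have : PreservesColimitsOfShape J F.flip := ⟨fun {G} => ⟨fun {c} hc =>
      ⟨evaluationJointlyReflectsColimits _ fun k => isColimitOfPreserves (F.obj k) hc⟩⟩⟩
    have : PreservesColimitsOfShape J (colim (J := K) (C := C)) :=
      (colimConstAdj.leftAdjoint_preservesColimits).preservesColimitsOfShape
    let e : F.flip ⋙ colim ≅ c.pt :=
      NatIso.ofComponents
        (fun j => (colimit.isColimit (F.flip.obj j)).coconePointUniqueUpToIso
          (isColimitOfPreserves ((evaluation _ _).obj j) hc))
        (fun f => by
          refine colimit.hom_ext fun k => ?_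
          have h1 : colimit.ι _ k ≫ (F.flip ⋙ colim).map f =
            (F.flip.map f).app k ≫ colimit.ι _ k := ι_colimMap _ _
          have h2 := fun j => (colimit.isColimit (F.flip.obj j)).comp_coconePointUniqueUpToIso_hom
            (isColimitOfPreserves ((evaluation _ _).obj j) hc) k
          refine (Category.assoc _ _ _).symm.trans ((congr_arg (· ≫ _) h1).trans
            ((Category.assoc _ _ _).trans ((congr_arg (_ ≫ ·) (h2 _)).trans ?_)))
          refine Eq.trans ?_ (Category.assoc _ _ _)
          refine Eq.trans ?_ (congr_arg (· ≫ _) (h2 _)).symm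
          exact (c.ι.app k).naturality f)
    exact preservesColimitsOfShape_of_natIso e

lemma prop_of_transfiniteComposition (P : ObjectProperty D) [P.IsClosedUnderIsomorphisms]
    (hP : ∀ {K : Type v} [SmallCategory K] {F : K ⥤ D} {c : Cocone F},
      IsColimit c → (∀ k, P (F.obj k)) → P c.pt)
    {J : Type v} [LinearOrder J] [SuccOrder J] [OrderBot J] [WellFoundedLT J] {X Y : D}
    {f : X ⟶ Y} (hf : TransfiniteCompositionOfShape J f) (hX : P X)
    (hs : ∀ j, ¬ IsMax j → P (hf.F.obj j) → P (hf.F.obj (Order.succ j))) : P Y := by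
  refine hP hf.isColimit fun j => ?_
  induction j using SuccOrder.limitRecOn with
  | isMin j hj =>
    obtain rfl := hj.eq_bot
    exact P.prop_of_iso hf.isoBot.symm hX
  | succ j hj hj' => exact hs j hj hj'
  | isSuccLimit j hj hj' =>
    exact hP (hf.F.isColimitOfIsWellOrderContinuous j hj) fun ⟨k, hk⟩ => hj' k hk

end

section

open SmallObject

variable (I : MorphismProperty C) (κ κ' : Cardinal.{v}) [Fact κ.IsRegular] [Fact κ'.IsRegular]
  [OrderBot κ.ord.ToType] [I.IsCardinalForSmallObjectArgument κ] [HasColimitsOfSize.{v, v} C]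

/-- The small object argument gives an accessible functor. -/
lemma isCardinalAccessible_iteration
    (hI : ∀ {X Y : C} (f : X ⟶ Y), I f → IsCardinalPresentable (Arrow.mk f) κ') :
    (iteration I κ).IsCardinalAccessible κ' := by
  have := hasColimitsOfShape_discrete I κ
  have hs : (functor I.homFamily).IsCardinalAccessible κ' :=
    isCardinalAccessible_smallObject_functor _ κ' fun i => hI _ i.2
  let P : ObjectProperty (Arrow C ⥤ Arrow C) := fun F => F.IsCardinalAccessible κ'
  have : P.IsClosedUnderIsomorphisms :=
    ⟨fun {F _} e (h : F.IsCardinalAccessible κ') => by exact Functor.isCardinalAccessible_of_natIso e κ'⟩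
  let h := transfiniteCompositionOfShapeSuccStructPropιIteration I κ
  refine prop_of_transfiniteComposition P (fun hc h => isCardinalAccessible_of_isColimit κ' hc h)
    h.toTransfiniteCompositionOfShape (inferInstance : (𝟭 (Arrow C)).IsCardinalAccessible κ')
    fun j hj hP => ?_
  have := hasIterationOfShape I κ
  let e := (succStruct I κ).iterationFunctorObjSuccIso j hj
  refine P.prop_of_iso e.symm ?_
  have h1 : ((iterationFunctor I κ).obj j).IsCardinalAccessible κ' := hP
  exact (inferInstance : ((iterationFunctor I κ).obj j ⋙
    functor I.homFamily).IsCardinalAccessible κ')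

end

universe w

section

lemma exists_cardinal_forall_isCardinalPresentable (κ₀ : Cardinal.{v}) [Fact κ₀.IsRegular]
    [IsCardinalLocallyPresentable C κ₀] {ι : Type w} [Small.{v} ι] (X : ι → C)
    (μ : Cardinal.{v}) :
    ∃ (κ : Cardinal.{v}) (_ : Fact κ.IsRegular), κ₀ ≤ κ ∧ μ ≤ κ ∧
      ∀ i, IsCardinalPresentable (X i) κ := by
  have : IsLocallyPresentable.{v} C := ⟨κ₀, inferInstance, inferInstance⟩
  choose c hc hX using fun i => (inferInstance : IsPresentable.{v} (X i)).exists_cardinal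
  let Y : Option (Option (Shrink.{v} ι)) → Type v := fun i =>
    i.elim κ₀.out fun i => i.elim μ.out fun i => (c ((equivShrink ι).symm i)).out
  obtain ⟨κ, hκ, h⟩ := HasCardinalLT.exists_regular_cardinal_forall.{v, v, v} Y
  simp only [hasCardinalLT_iff_cardinal_mk_lt] at h
  have : Fact κ.IsRegular := ⟨hκ⟩
  refine ⟨κ, this, ?_, ?_, fun i => ?_⟩
  · simpa [Y] using (h none).le
  · simpa [Y] using (h (some none)).le
  · have h1 : c i ≤ κ := by simpa [Y] using (h (some (some (equivShrink ι i)))).le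
    exact isCardinalPresentable_of_le _ h1

lemma exists_isCardinalForSmallObjectArgument (κ₀ : Cardinal.{v}) [Fact κ₀.IsRegular]
    [IsCardinalLocallyPresentable C κ₀] (I : MorphismProperty C)
    [MorphismProperty.IsSmall.{v} I] :
    ∃ (κ : Cardinal.{v}) (_ : Fact κ.IsRegular) (_ : OrderBot κ.ord.ToType),
      I.IsCardinalForSmallObjectArgument κ := by
  have : Small.{v} I.toSet := MorphismProperty.IsSmall.small_toSet
  obtain ⟨κ, hκ, h₀, -, h⟩ := exists_cardinal_forall_isCardinalPresentable κ₀
    (fun i : I.toSet => i.1.left) 0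
  have : HasColimitsOfSize.{v, v} C :=
    (inferInstance : IsCardinalLocallyPresentable C κ₀).toHasColimitsOfSize
  have : Nonempty κ.ord.ToType := by simpa using hκ.out.ne_zero
  have := WellFoundedLT.toOrderBot κ.ord.ToType
  have : HasIterationOfShape κ.ord.ToType C := { }
  have : HasPushouts C := (hasColimitsOfSizeShrink.{0, 0, v, v} C).has_colimits_of_shape _
  refine ⟨κ, hκ, inferInstance, { preservesColimit := fun {A B X Y} i hi f hf => ?_ }⟩
  have : IsCardinalPresentable A κ := h ⟨Arrow.mk i, hi⟩
  have := preservesColimitsOfShape_of_isCardinalPresentable A κ κ.ord.ToType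
  infer_instance

lemma hasSmallObjectArgument (κ₀ : Cardinal.{v}) [Fact κ₀.IsRegular]
    [IsCardinalLocallyPresentable C κ₀] (I : MorphismProperty C) [MorphismProperty.IsSmall.{v} I] :
    MorphismProperty.HasSmallObjectArgument.{v} I :=
  ⟨exists_isCardinalForSmallObjectArgument κ₀ I⟩

end

/-- A lift of a coalgebra structure to a transition map of a diagram. -/
structure PartialCoalgebra {J : Type v} [SmallCategory J] {x : C} {D : J ⥤ C}
    (ι : D ⟶ (Functor.const J).obj x)
    {F G : C ⥤ C} (α : F ⟶ G) (β : 𝟭 C ⟶ G) (s : x ⟶ F.obj x) where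
  j₀ : J
  j₁ : J
  f : j₀ ⟶ j₁
  t : D.obj j₀ ⟶ F.obj (D.obj j₁)
  t_map : t ≫ F.map (ι.app j₁ : D.obj j₁ ⟶ x) = (ι.app j₀ : D.obj j₀ ⟶ x) ≫ s
  t_app : t ≫ α.app _ = β.app (D.obj j₀) ≫ G.map (D.map f)

section

variable (κ : Cardinal.{v}) [Fact κ.IsRegular] {J : Type v} [SmallCategory J]
  [CategoryTheory.IsCardinalFiltered J κ] {x : C} {D : J ⥤ C} {ι : D ⟶ (Functor.const J).obj x}
  (hc : IsColimit (Cocone.mk x ι)) (hD : ∀ j, IsCardinalPresentable (D.obj j) κ)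
  (F G : C ⥤ C) [F.IsCardinalAccessible κ] [G.IsCardinalAccessible κ] (α : F ⟶ G) (β : 𝟭 C ⟶ G)
  (s : x ⟶ F.obj x)

include hc hD in
lemma PartialCoalgebra.exists_of (hs : s ≫ α.app x = β.app x) (j₀ : J) :
    ∃ p : PartialCoalgebra ι α β s, p.j₀ = j₀ := by
  have := isFiltered_of_isCardinalFiltered J κ
  have := F.preservesColimitsOfShape_of_isCardinalAccessible κ J
  have := G.preservesColimitsOfShape_of_isCardinalAccessible κ J
  have w : ∀ {i j : J} (f : i ⟶ j), D.map f ≫ (ι.app j : D.obj j ⟶ x) = ι.app i := fun f => by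
    simp
  obtain ⟨j, t, ht⟩ : ∃ (j : J) (t : D.obj j₀ ⟶ F.obj (D.obj j)),
      t ≫ F.map (ι.app j : D.obj j ⟶ x) = (ι.app j₀ : D.obj j₀ ⟶ x) ≫ s :=
    exists_hom_map_of_isColimit F hc (hD j₀) _
  let j' := IsFiltered.max j₀ j
  obtain ⟨k, a, ha⟩ : ∃ (k : J) (a : j' ⟶ k),
      (t ≫ F.map (D.map (IsFiltered.rightToMax j₀ j)) ≫ α.app _) ≫ G.map (D.map a) =
        (β.app (D.obj j₀) ≫ G.map (D.map (IsFiltered.leftToMax j₀ j))) ≫ G.map (D.map a) := by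
    refine exists_eq_map_of_isColimit G hc (hD j₀) _ _ ?_
    change (t ≫ F.map (D.map (IsFiltered.rightToMax j₀ j)) ≫ α.app _) ≫
      G.map (ι.app j' : D.obj j' ⟶ x) =
        (β.app (D.obj j₀) ≫ G.map (D.map (IsFiltered.leftToMax j₀ j))) ≫
          G.map (ι.app j' : D.obj j' ⟶ x)
    simp only [Category.assoc, ← Functor.map_comp, w, j', ← α.naturality]
    rw [← Functor.map_comp_assoc, w, reassoc_of% ht]
    exact (congr_arg (_ ≫ ·) hs).trans (β.naturality (ι.app j₀ : D.obj j₀ ⟶ x))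
  refine ⟨⟨j₀, k, IsFiltered.leftToMax j₀ j ≫ a,
    t ≫ F.map (D.map (IsFiltered.rightToMax j₀ j ≫ a)), ?_, ?_⟩, rfl⟩
  · rw [Category.assoc, ← F.map_comp, w, ht]
  · simpa using ha

include hc hD in
lemma PartialCoalgebra.exists_next (hs : s ≫ α.app x = β.app x) (p : PartialCoalgebra ι α β s) :
    ∃ q : PartialCoalgebra ι α β s, ∃ h : q.j₀ = p.j₁,
      D.map (p.f ≫ eqToHom h.symm) ≫ q.t = p.t ≫ F.map (D.map (eqToHom h.symm ≫ q.f)) := by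
  have := isFiltered_of_isCardinalFiltered J κ
  have := F.preservesColimitsOfShape_of_isCardinalAccessible κ J
  have := G.preservesColimitsOfShape_of_isCardinalAccessible κ J
  have w : ∀ {i j : J} (f : i ⟶ j), D.map f ≫ (ι.app j : D.obj j ⟶ x) = ι.app i := fun f => by
    simp
  obtain ⟨⟨j₀, j₁, f, t, h₁, h₂⟩, rfl⟩ := PartialCoalgebra.exists_of κ hc hD F G α β s hs p.j₁
  obtain ⟨k, a, ha⟩ : ∃ (k : J) (a : j₁ ⟶ k),
      (D.map p.f ≫ t) ≫ F.map (D.map a) = (p.t ≫ F.map (D.map f)) ≫ F.map (D.map a) := by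
    refine exists_eq_map_of_isColimit F hc (hD _) _ _ ?_
    change (D.map p.f ≫ t) ≫ F.map (ι.app j₁ : D.obj j₁ ⟶ x) =
      (p.t ≫ F.map (D.map f)) ≫ F.map (ι.app j₁ : D.obj j₁ ⟶ x)
    rw [Category.assoc, h₁, Category.assoc, ← F.map_comp, w, p.t_map, reassoc_of% (w p.f)]
  refine ⟨⟨p.j₁, k, f ≫ a, t ≫ F.map (D.map a), ?_, ?_⟩, rfl, ?_⟩
  · rw [Category.assoc, ← F.map_comp, w, h₁]
  · rw [Category.assoc, α.naturality, reassoc_of% h₂, D.map_comp, G.map_comp]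
  · simpa using ha

include hc hD in
lemma exists_coalgebra_sequence (hs : s ≫ α.app x = β.app x) (i : J) :
    ∃ (j : ℕ → J) (f : ∀ n, j n ⟶ j (n + 1)) (t : ∀ n, D.obj (j n) ⟶ F.obj (D.obj (j (n + 1)))),
      j 0 = i ∧ (∀ n, t n ≫ α.app _ = β.app (D.obj (j n)) ≫ G.map (D.map (f n))) ∧
      ∀ n, D.map (f n) ≫ t (n + 1) = t n ≫ F.map (D.map (f (n + 1))) := by
  obtain ⟨p₀, rfl⟩ := PartialCoalgebra.exists_of κ hc hD F G α β s hs i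
  choose next h hnext using PartialCoalgebra.exists_next κ hc hD F G α β s hs
  let p : ℕ → PartialCoalgebra ι α β s := fun n => Nat.rec p₀ (fun _ => next) n
  have e (n) : (p (n + 1)).j₀ = (p n).j₁ := h (p n)
  refine ⟨fun n => (p n).j₀, fun n => (p n).f ≫ eqToHom (e n).symm,
    fun n => (p n).t ≫ F.map (D.map (eqToHom (e n).symm)), rfl, fun n => ?_, fun n => ?_⟩
  · rw [Category.assoc, α.naturality, reassoc_of% (p n).t_app, D.map_comp, G.map_comp]
  · have := hnext (p n) =≫ F.map (D.map (eqToHom (e (n + 1)).symm))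
    simp only [Functor.map_comp, Category.assoc] at this ⊢
    exact this

end

lemma exists_desc_ofSequence {X : ℕ → C} (u : ∀ n, X n ⟶ X (n + 1))
    [HasColimit (Functor.ofSequence u)] {Z : C} (g : ∀ n, X n ⟶ Z)
    (hg : ∀ n, u n ≫ g (n + 1) = g n) :
    ∃ d : colimit (Functor.ofSequence u) ⟶ Z,
      ∀ n, colimit.ι (Functor.ofSequence u) n ≫ d = g n := by
  refine ⟨colimit.desc _ (Cocone.mk Z (NatTrans.ofSequence g fun n => ?_)), fun n => ?_⟩
  · rw [Functor.ofSequence_map_homOfLE_succ]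
    exact (hg n).trans (Category.comp_id _).symm
  · exact colimit.ι_desc _ n

/-- Coalgebra-like structures for accessible functors are generated by a small family. -/
lemma exists_small_coalgebra_family (κ : Cardinal.{v}) [Fact κ.IsRegular]
    [IsCardinalLocallyPresentable C κ] (F G : C ⥤ C) [F.IsCardinalAccessible κ]
    [G.IsCardinalAccessible κ] (α : F ⟶ G) (β : 𝟭 C ⟶ G) :
    ∃ (ι : Type (max u v)) (_ : Small.{v} ι) (y : ι → C),
      (∀ i, ∃ s : y i ⟶ F.obj (y i), s ≫ α.app (y i) = β.app (y i)) ∧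
      ∀ {k x : C} [IsCardinalPresentable k κ] (s : x ⟶ F.obj x), s ≫ α.app x = β.app x →
        ∀ m : k ⟶ x, ∃ (i : ι) (a : k ⟶ y i) (b : y i ⟶ x), a ≫ b = m := by
  have : HasColimitsOfSize.{v, v} C :=
    (inferInstance : IsCardinalLocallyPresentable C κ).toHasColimitsOfSize
  have : HasColimitsOfShape ℕ C := (hasColimitsOfSizeShrink.{0, 0, v, v} C).has_colimits_of_shape _
  obtain ⟨P, _, hP⟩ := HasCardinalFilteredGenerator.exists_small_generator C κ
  have : Small.{v} (Subtype P) := ‹ObjectProperty.Small.{v} P›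
  let T := Σ X : ℕ → Subtype P, ∀ n, (X n).1 ⟶ (X (n + 1)).1
  let Y : T → C := fun a => colimit (Functor.ofSequence a.2)
  refine ⟨{ a : T // ∃ s : Y a ⟶ F.obj (Y a), s ≫ α.app (Y a) = β.app (Y a) }, inferInstance,
    fun a => Y a.1, fun a => a.2, fun {k x} _ s hs m => ?_⟩
  obtain ⟨J, _, _, ⟨p⟩⟩ := hP.exists_colimitsOfShape x
  have hD (j) := hP.le_isCardinalPresentable _ (p.prop_diag_obj j)
  obtain ⟨i, m', hm⟩ := IsCardinalPresentable.exists_hom_of_isColimit κ p.isColimit m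
  obtain ⟨j, f, t, rfl, h₁, h₂⟩ := exists_coalgebra_sequence κ p.isColimit hD F G α β s hs i
  let a : T := ⟨fun n => ⟨p.diag.obj (j n), p.prop_diag_obj _⟩, fun n => p.diag.map (f n)⟩
  let c (n : ℕ) : p.diag.obj (j n) ⟶ Y a := colimit.ι (Functor.ofSequence a.2) n
  have hc (n) : p.diag.map (f n) ≫ c (n + 1) = c n := by
    have := colimit.w (Functor.ofSequence a.2) (homOfLE (Nat.le_add_right n 1))
    rwa [Functor.ofSequence_map_homOfLE_succ] at this
  obtain ⟨s', hs'⟩ := exists_desc_ofSequence a.2 (fun n => t n ≫ F.map (c (n + 1))) fun n =>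
    (by rw [reassoc_of% (h₂ n), ← F.map_comp, hc] :
      p.diag.map (f n) ≫ t (n + 1) ≫ F.map (c (n + 1 + 1)) = t n ≫ F.map (c (n + 1)))
  obtain ⟨b, hb⟩ := exists_desc_ofSequence a.2 (fun n => p.ι.app (j n)) fun n => p.w (f n)
  refine ⟨⟨a, s', colimit.hom_ext fun n => ?_⟩, m' ≫ c 0, b, ?_⟩
  · change c n ≫ _ = c n ≫ _
    have h : (t n ≫ F.map (c (n + 1))) ≫ α.app (Y a) = c n ≫ β.app (Y a) := by
      rw [Category.assoc, α.naturality, reassoc_of% (h₁ n), ← G.map_comp, hc]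
      exact (β.naturality (c n)).symm
    exact ((Category.assoc _ _ _).symm.trans (congr_arg (· ≫ α.app (Y a)) (hs' n))).trans h
  · rw [Category.assoc]
    exact (congr_arg (m' ≫ ·) (hb 0)).trans hm

lemma exists_accessible_factorization (κ₀ : Cardinal.{v}) [Fact κ₀.IsRegular]
    [IsCardinalLocallyPresentable C κ₀] (I Λ : MorphismProperty C)
    [MorphismProperty.IsSmall.{v} I] [MorphismProperty.IsSmall.{v} Λ] :
    ∃ (κ : Cardinal.{v}) (_ : Fact κ.IsRegular) (Q : Arrow C ⥤ Arrow C) (e : 𝟭 (Arrow C) ⟶ Q),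
      κ₀ ≤ κ ∧ Q.IsCardinalAccessible κ ∧
      (∀ f, Λ.rlp.llp (e.app f).left ∧ IsIso (e.app f).right ∧ Λ.rlp (Q.obj f).hom) ∧
      ∀ {K M : C} (k : K ⟶ M), I k → IsCardinalPresentable (Arrow.mk k) κ := by
  have : HasColimitsOfSize.{v, v} C :=
    (inferInstance : IsCardinalLocallyPresentable C κ₀).toHasColimitsOfSize
  obtain ⟨κ₁, _, _, _⟩ := exists_isCardinalForSmallObjectArgument κ₀ Λ
  have := isCardinalLocallyPresentable_arrow (C := C) κ₀
  obtain ⟨κ, _, h₀, -, h⟩ := exists_cardinal_forall_isCardinalPresentable (C := Arrow C) κ₀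
    (Sum.elim (fun i : I.toSet => i.1) (fun i : Λ.toSet => i.1)) 0
  refine ⟨κ, inferInstance, SmallObject.iteration Λ κ₁, SmallObject.ιIteration Λ κ₁, h₀,
    isCardinalAccessible_iteration Λ κ₁ κ fun f hf => h (.inr ⟨Arrow.mk f, hf⟩),
    fun f => ⟨SmallObject.llp_rlp_ιObj Λ κ₁ f.hom, inferInstance, ?_⟩,
    fun k hk => h (.inl ⟨Arrow.mk k, hk⟩)⟩
  have : SmallObject.πObj Λ κ₁ f.hom ≫ ((SmallObject.ιIteration Λ κ₁).app f).right =
      ((SmallObject.iteration Λ κ₁).obj f).hom := SmallObject.πObj_ιIteration_app_right Λ κ₁ f.hom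
  rw [← this]
  exact Λ.rlp.comp_mem _ _ (SmallObject.rlp_πObj Λ κ₁ f.hom)
    (MorphismProperty.of_isIso _ _)

lemma isCardinalAccessible_toArrow (κ : Cardinal.{v}) [Fact κ.IsRegular] {D : Type*} [Category* D]
    (T : D ⥤ Arrow C) (hl : (T ⋙ Arrow.leftFunc).IsCardinalAccessible κ)
    (hr : (T ⋙ Arrow.rightFunc).IsCardinalAccessible κ) : T.IsCardinalAccessible κ where
  preservesColimitOfShape J _ _ := ⟨fun {H} => ⟨fun {c} hc => by
    have := (T ⋙ Arrow.leftFunc).preservesColimitsOfShape_of_isCardinalAccessible κ J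
    have := (T ⋙ Arrow.rightFunc).preservesColimitsOfShape_of_isCardinalAccessible κ J
    exact arrow_isColimit_of_left_right ⟨isColimitOfPreserves (T ⋙ Arrow.leftFunc) hc⟩
      ⟨isColimitOfPreserves (T ⋙ Arrow.rightFunc) hc⟩⟩⟩

lemma isCardinalAccessible_leftFunc (κ : Cardinal.{v}) [Fact κ.IsRegular]
    [HasColimitsOfSize.{v, v} C] : (Arrow.leftFunc : Arrow C ⥤ C).IsCardinalAccessible κ where

lemma isCardinalAccessible_rightFunc (κ : Cardinal.{v}) [Fact κ.IsRegular]
    [HasColimitsOfSize.{v, v} C] : (Arrow.rightFunc : Arrow C ⥤ C).IsCardinalAccessible κ where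

/-- The functor sending an object to its map to the terminal object. -/
@[simps]
noncomputable def toTerminalFunctor (C : Type u) [Category.{v} C] [HasTerminal C] : C ⥤ Arrow C where
  obj X := Arrow.mk (terminal.from X)
  map f := Arrow.homMk f (𝟙 _)

/-- The functor sending an object to its identity. -/
@[simps]
def idArrowFunctor (C : Type u) [Category.{v} C] : C ⥤ Arrow C where
  obj X := Arrow.mk (𝟙 X)
  map f := Arrow.homMk f f

/-- Postcomposition of arrows with a natural transformation. -/
@[simps]
def postcompArrowFunctor {Ψ : C ⥤ C} (η : 𝟭 C ⟶ Ψ) : Arrow C ⥤ Arrow C where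
  obj f := Arrow.mk (f.hom ≫ η.app f.right)
  map φ := Arrow.homMk φ.left (Ψ.map φ.right) (by
    have := η.naturality φ.right
    simp_all [← this])

/-- A small solution set for the maps having the left lifting property against the maps of `Λ.rlp`
with fibrant codomain. -/
lemma exists_solution_set [HasTerminal C] (κ₀ : Cardinal.{v}) [Fact κ₀.IsRegular]
    [IsCardinalLocallyPresentable C κ₀] (I Λ : MorphismProperty C)
    [MorphismProperty.IsSmall.{v} I] [MorphismProperty.IsSmall.{v} Λ] :
    ∃ (S : MorphismProperty C) (_ : MorphismProperty.IsSmall.{v} S),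
      (∀ {A B : C} (i : A ⟶ B), S i → ∃ (A' B' : C) (jA : A ⟶ A') (jB : B ⟶ B') (s : B ⟶ A')
        (q : A' ⟶ B'), Λ.rlp.llp jA ∧ Λ.rlp.llp jB ∧ i ≫ s = jA ∧ s ≫ q = jB) ∧
      ∀ {A B : C} (i : A ⟶ B),
        (∀ {X Y : C} (p : X ⟶ Y), Λ.rlp p → Λ.rlp (terminal.from Y) → HasLiftingProperty i p) →
        ∀ {K M : C} (k : K ⟶ M), I k → ∀ m : Arrow.mk k ⟶ Arrow.mk i,
          ∃ (x : Arrow C) (a : Arrow.mk k ⟶ x) (b : x ⟶ Arrow.mk i), S x.hom ∧ a ≫ b = m := by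
  obtain ⟨κ, _, Q, e, h₀, _, he, hI⟩ := exists_accessible_factorization κ₀ I Λ
  have := IsCardinalLocallyPresentable.of_le C h₀
  have : HasColimitsOfSize.{v, v} C :=
    (inferInstance : IsCardinalLocallyPresentable C κ₀).toHasColimitsOfSize
  have := isCardinalLocallyPresentable_arrow (C := C) κ
  have := isCardinalAccessible_leftFunc (C := C) κ
  have := isCardinalAccessible_rightFunc (C := C) κ
  have hT : (toTerminalFunctor C).IsCardinalAccessible κ := isCardinalAccessible_toArrow κ _
    (inferInstanceAs ((𝟭 C).IsCardinalAccessible κ))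
    (inferInstanceAs (((Functor.const C).obj (⊤_ C)).IsCardinalAccessible κ))
  let Ψ : C ⥤ C := toTerminalFunctor C ⋙ Q ⋙ Arrow.leftFunc
  let η : 𝟭 C ⟶ Ψ :=
    { app := fun B => (e.app (Arrow.mk (terminal.from B))).left
      naturality := fun B B' f =>
        congr_arg CommaMorphism.left (e.naturality ((toTerminalFunctor C).map f)) }
  have hU : (postcompArrowFunctor η).IsCardinalAccessible κ := isCardinalAccessible_toArrow κ _
    (inferInstanceAs ((Arrow.leftFunc : Arrow C ⥤ C).IsCardinalAccessible κ))
    (inferInstanceAs ((Arrow.rightFunc ⋙ Ψ : Arrow C ⥤ C).IsCardinalAccessible κ))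
  have hid : (idArrowFunctor C).IsCardinalAccessible κ := isCardinalAccessible_toArrow κ _
    (inferInstanceAs ((𝟭 C).IsCardinalAccessible κ))
    (inferInstanceAs ((𝟭 C).IsCardinalAccessible κ))
  let G := postcompArrowFunctor η ⋙ Q
  let F := G ⋙ Arrow.leftFunc ⋙ idArrowFunctor C
  let α : F ⟶ G :=
    { app := fun i => Arrow.homMk (𝟙 _) (G.obj i).hom
      naturality := fun i j φ => by
        ext
        · exact (Category.comp_id _).trans (Category.id_comp _).symm
        · exact (G.map φ).w }
  let υ : 𝟭 (Arrow C) ⟶ postcompArrowFunctor η :=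
    { app := fun i => Arrow.homMk (𝟙 _) (η.app i.right) (Category.id_comp _)
      naturality := fun i j φ => by
        ext
        · exact (Category.comp_id _).trans (Category.id_comp _).symm
        · exact η.naturality φ.right }
  let β : 𝟭 (Arrow C) ⟶ G := υ ≫ Functor.whiskerLeft (postcompArrowFunctor η) e
  have hβl (i : Arrow C) : (β.app i).left = (e.app ((postcompArrowFunctor η).obj i)).left :=
    Category.id_comp _
  have hβr (i : Arrow C) : (β.app i).right =
      η.app i.right ≫ (e.app ((postcompArrowFunctor η).obj i)).right := rfl
  obtain ⟨ι, _, y, hy, hm⟩ := exists_small_coalgebra_family κ F G α β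
  refine ⟨MorphismProperty.ofHoms fun i => (y i).hom, inferInstance, ?_, ?_⟩
  · rintro _ _ _ ⟨i⟩
    obtain ⟨s, hs⟩ := hy i
    refine ⟨_, _, (β.app (y i)).left, (β.app (y i)).right, s.right, (G.obj (y i)).hom, ?_, ?_, ?_, ?_⟩
    · rw [hβl]
      exact (he _).1
    · rw [hβr]
      have := (he ((postcompArrowFunctor η).obj (y i))).2.1
      exact MorphismProperty.comp_mem _ _ _ (he (Arrow.mk (terminal.from (y i).right))).1
        (MorphismProperty.of_isIso _ _)
    · have h₁ : s.left ≫ 𝟙 (G.obj (y i)).left = (y i).hom ≫ s.right := Arrow.w s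
      have h₂ : s.left ≫ 𝟙 (G.obj (y i)).left = (β.app (y i)).left :=
        congr_arg CommaMorphism.left hs
      exact h₁.symm.trans h₂
    · exact congr_arg CommaMorphism.right hs
  · intro A B i hi K M k hk m
    have := hI k hk
    have hq : Λ.rlp (G.obj (Arrow.mk i)).hom := (he _).2.2
    have hB := (he (Arrow.mk (terminal.from B))).2.2
    have := (he (Arrow.mk (terminal.from B))).2.1
    have hu := (he ((postcompArrowFunctor η).obj (Arrow.mk i))).2.1
    have hY : Λ.rlp (terminal.from (G.obj (Arrow.mk i)).right) := by
      have h : terminal.from (G.obj (Arrow.mk i)).right =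
        inv (e.app ((postcompArrowFunctor η).obj (Arrow.mk i))).right ≫
          (Q.obj (Arrow.mk (terminal.from B))).hom ≫
            inv (e.app (Arrow.mk (terminal.from B))).right := Subsingleton.elim _ _
      rw [h]
      exact MorphismProperty.comp_mem _ _ _ (MorphismProperty.of_isIso _ _)
        (MorphismProperty.comp_mem _ _ _ hB (MorphismProperty.of_isIso _ _))
    have := hi _ hq hY
    have sq : CommSq (β.app (Arrow.mk i)).left i (G.obj (Arrow.mk i)).hom
      (β.app (Arrow.mk i)).right := ⟨Arrow.w (β.app (Arrow.mk i))⟩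
    obtain ⟨j, a, b, hab⟩ := hm (x := Arrow.mk i)
      (Arrow.homMk (β.app (Arrow.mk i)).left sq.lift
        ((Category.comp_id _).trans sq.fac_left.symm) : _ ⟶ F.obj (Arrow.mk i)) (by
        ext
        · exact Category.comp_id _
        · exact sq.fac_right) m
    exact ⟨y j, a, b, ⟨j⟩, hab⟩

namespace Cylinder

variable (E : Cylinder C)

/-- The first end of the cylinder. -/
def i₀ (X : C) : X ⟶ E.I.obj X := E.d0.app X

/-- The second end of the cylinder. -/
def i₁ (X : C) : X ⟶ E.I.obj X := E.d1.app X

/-- The projection of the cylinder. -/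
def pr (X : C) : E.I.obj X ⟶ X := E.σ.app X

lemma i₀_pr (X : C) : E.i₀ X ≫ E.pr X = 𝟙 X := E.d0_σ X

lemma i₁_pr (X : C) : E.i₁ X ≫ E.pr X = 𝟙 X := E.d1_σ X

lemma i₀_naturality {X Y : C} (f : X ⟶ Y) : f ≫ E.i₀ Y = E.i₀ X ≫ E.I.map f := E.d0_naturality' f

lemma i₁_naturality {X Y : C} (f : X ⟶ Y) : f ≫ E.i₁ Y = E.i₁ X ≫ E.I.map f := E.d1_naturality' f

lemma pr_naturality {X Y : C} (f : X ⟶ Y) : E.I.map f ≫ E.pr Y = E.pr X ≫ f := E.σ.naturality f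

lemma i₀_pr_assoc (X : C) {Z : C} (h : X ⟶ Z) : E.i₀ X ≫ E.pr X ≫ h = h :=
  (reassoc_of% (E.i₀_pr X)) h

lemma i₁_pr_assoc (X : C) {Z : C} (h : X ⟶ Z) : E.i₁ X ≫ E.pr X ≫ h = h :=
  (reassoc_of% (E.i₁_pr X)) h

lemma i₀_naturality_assoc {X Y Z : C} (f : X ⟶ Y) (h : E.I.obj Y ⟶ Z) :
    f ≫ E.i₀ Y ≫ h = E.i₀ X ≫ E.I.map f ≫ h :=
  (reassoc_of% (E.i₀_naturality f)) h

lemma i₁_naturality_assoc {X Y Z : C} (f : X ⟶ Y) (h : E.I.obj Y ⟶ Z) :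
    f ≫ E.i₁ Y ≫ h = E.i₁ X ≫ E.I.map f ≫ h :=
  (reassoc_of% (E.i₁_naturality f)) h

lemma pr_naturality_assoc {X Y Z : C} (f : X ⟶ Y) (h : Y ⟶ Z) :
    E.I.map f ≫ E.pr Y ≫ h = E.pr X ≫ f ≫ h :=
  (reassoc_of% (E.pr_naturality f)) h

lemma homotopy_iff {X Y : C} {f g : X ⟶ Y} :
    E.Homotopy f g ↔ ∃ h : E.I.obj X ⟶ Y, E.i₀ X ≫ h = f ∧ E.i₁ X ≫ h = g := Iff.rfl

end Cylinder

/-- The lifting properties of a cylinder, with respect to a class `L` of cofibrations and a class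
`An` of anodyne extensions, from which the model structure is built. -/
structure CylinderLifting (E : Cylinder C) (L An : MorphismProperty C) : Prop where
  le : An ≤ L
  exists_lift {Z X Y : C} (p : X ⟶ Y) (hp : L.rlp p) (y : Z ⟶ Y) : ∃ x : Z ⟶ X, x ≫ p = y
  exists_lift_cylinder {Z X Y : C} (p : X ⟶ Y) (hp : L.rlp p) (x₀ x₁ : Z ⟶ X)
    (b : E.I.obj Z ⟶ Y) (h₀ : E.i₀ Z ≫ b = x₀ ≫ p) (h₁ : E.i₁ Z ≫ b = x₁ ≫ p) :
    ∃ h : E.I.obj Z ⟶ X, E.i₀ Z ≫ h = x₀ ∧ E.i₁ Z ≫ h = x₁ ∧ h ≫ p = b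
  exists_lift_end {Z X Y : C} (p : X ⟶ Y) (hp : An.rlp p) (x : Z ⟶ X)
    (b : E.I.obj Z ⟶ Y) (h₁ : E.i₁ Z ≫ b = x ≫ p) :
    ∃ h : E.I.obj Z ⟶ X, E.i₁ Z ≫ h = x ∧ h ≫ p = b
  exists_lift_box {K M X Y : C} (k : K ⟶ M) (hk : L k) (p : X ⟶ Y) (hp : An.rlp p)
    (m : M ⟶ X) (h : E.I.obj K ⟶ X) (b : E.I.obj M ⟶ Y) (h₁ : k ≫ m = E.i₁ K ≫ h)
    (h₂ : E.i₁ M ≫ b = m ≫ p) (h₃ : E.I.map k ≫ b = h ≫ p) :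
    ∃ H : E.I.obj M ⟶ X, E.i₁ M ≫ H = m ∧ E.I.map k ≫ H = h ∧ H ≫ p = b
  exists_extension {K M X Y : C} (k : K ⟶ M) (hk : An k) (p : X ⟶ Y) (hp : An.rlp p)
    (b₀ b₁ : M ⟶ X) (h : E.I.obj K ⟶ X) (b : E.I.obj M ⟶ Y) (h₀ : E.i₀ K ≫ h = k ≫ b₀)
    (h₁ : E.i₁ K ≫ h = k ≫ b₁) (h₂ : E.i₀ M ≫ b = b₀ ≫ p) (h₃ : E.i₁ M ≫ b = b₁ ≫ p)
    (h₄ : E.I.map k ≫ b = h ≫ p) :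
    ∃ H : E.I.obj M ⟶ X, E.i₀ M ≫ H = b₀ ∧ E.i₁ M ≫ H = b₁ ∧ H ≫ p = b
  exists_lift_square {Z X Y : C} (p : X ⟶ Y) (hp : An.rlp p) (u v w : E.I.obj Z ⟶ X)
    (b : E.I.obj (E.I.obj Z) ⟶ Y) (h₀ : E.i₀ Z ≫ w = E.i₁ Z ≫ u)
    (h₁ : E.i₁ Z ≫ w = E.i₁ Z ≫ v) (hu : E.I.map (E.i₀ Z) ≫ b = u ≫ p)
    (hv : E.I.map (E.i₁ Z) ≫ b = v ≫ p) (hw : E.i₁ (E.I.obj Z) ≫ b = w ≫ p) :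
    ∃ H : E.I.obj (E.I.obj Z) ⟶ X, E.I.map (E.i₀ Z) ≫ H = u ∧
      E.I.map (E.i₁ Z) ≫ H = v ∧ H ≫ p = b

section

variable {E : Cylinder C} {L An : MorphismProperty C}

lemma isFibrantObj_iff_terminal [HasTerminal C] (An : MorphismProperty C) (W : C) :
    IsFibrantObj An W ↔ An.rlp (terminal.from W) := by
  constructor
  · intro h A B f hf
    refine ⟨fun {a b} sq => ?_⟩
    obtain ⟨c, hc⟩ := h f hf a
    exact ⟨⟨⟨c, hc, Subsingleton.elim _ _⟩⟩⟩
  · intro h A B f hf a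
    have := h f hf
    have sq : CommSq a f (terminal.from W) (terminal.from B) := ⟨Subsingleton.elim _ _⟩
    exact ⟨sq.lift, sq.fac_left⟩

lemma Cylinder.Homotopy.refl {X Y : C} (f : X ⟶ Y) : E.Homotopy f f :=
  ⟨E.pr X ≫ f, E.i₀_pr_assoc _ f, E.i₁_pr_assoc _ f⟩

lemma Cylinder.Homotopy.postcomp {X Y Z : C} {f g : X ⟶ Y} (h : E.Homotopy f g) (k : Y ⟶ Z) :
    E.Homotopy (f ≫ k) (g ≫ k) := by
  obtain ⟨h, rfl, rfl⟩ := h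
  exact ⟨h ≫ k, (Category.assoc _ _ _).symm, (Category.assoc _ _ _).symm⟩

/-- The missing face of a square of homotopies. -/
lemma CylinderLifting.exists_face (H : CylinderLifting E L An) {Z X Y : C} (p : X ⟶ Y)
    (hp : An.rlp p) (u v w : E.I.obj Z ⟶ X)
    (b : E.I.obj (E.I.obj Z) ⟶ Y) (h₀ : E.i₀ Z ≫ w = E.i₁ Z ≫ u)
    (h₁ : E.i₁ Z ≫ w = E.i₁ Z ≫ v) (hu : E.I.map (E.i₀ Z) ≫ b = u ≫ p)
    (hv : E.I.map (E.i₁ Z) ≫ b = v ≫ p) (hw : E.i₁ (E.I.obj Z) ≫ b = w ≫ p) :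
    ∃ e : E.I.obj Z ⟶ X, E.i₀ Z ≫ e = E.i₀ Z ≫ u ∧
      E.i₁ Z ≫ e = E.i₀ Z ≫ v ∧ e ≫ p = E.i₀ (E.I.obj Z) ≫ b := by
  obtain ⟨K, rfl, rfl, rfl⟩ := H.exists_lift_square p hp u v w b h₀ h₁ hu hv hw
  refine ⟨E.i₀ (E.I.obj Z) ≫ K, ?_, ?_, by simp⟩
  · rw [← E.i₀_naturality_assoc]
  · rw [← E.i₀_naturality_assoc]

variable [HasTerminal C]

lemma CylinderLifting.homotopy_of_homotopy (H : CylinderLifting E L An) {Z W : C}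
    (hW : IsFibrantObj An W) {a b c : Z ⟶ W} (hac : E.Homotopy a c) (hbc : E.Homotopy b c) :
    E.Homotopy a b := by
  obtain ⟨u, rfl, hu⟩ := E.homotopy_iff.1 hac
  obtain ⟨v, rfl, rfl⟩ := E.homotopy_iff.1 hbc
  obtain ⟨w, hw₀, hw₁⟩ := E.homotopy_iff.1 <| Cylinder.Homotopy.refl (E := E) (E.i₁ Z ≫ v)
  obtain ⟨e, h₀, h₁, -⟩ := H.exists_face (terminal.from W)
    ((isFibrantObj_iff_terminal An W).1 hW) u v w (terminal.from _) (hw₀.trans hu.symm) hw₁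
    (Subsingleton.elim _ _) (Subsingleton.elim _ _) (Subsingleton.elim _ _)
  exact ⟨e, h₀, h₁⟩

lemma CylinderLifting.homotopy_symm (H : CylinderLifting E L An) {Z W : C}
    (hW : IsFibrantObj An W) {a b : Z ⟶ W} (h : E.Homotopy a b) : E.Homotopy b a :=
  H.homotopy_of_homotopy hW (.refl b) h

lemma CylinderLifting.mk_eq_mk_iff (H : CylinderLifting E L An) {Z W : C}
    (hW : IsFibrantObj An W) {a b : Z ⟶ W} :
    (Quot.mk _ a : E.HoHom Z W) = Quot.mk _ b ↔ E.Homotopy a b := by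
  refine Quot.eq.trans (Equivalence.eqvGen_iff ⟨fun _ => .refl _, H.homotopy_symm hW,
    fun h₁ h₂ => H.homotopy_of_homotopy hW h₁ (H.homotopy_symm hW h₂)⟩)

end

section

variable {E : Cylinder C} {L An : MorphismProperty C}

lemma Cylinder.precompQ_comp {X Y Z : C} (f : X ⟶ Y) (g : Y ⟶ Z) (W : C) :
    E.precompQ (f ≫ g) W = E.precompQ f W ∘ E.precompQ g W := by
  funext a
  induction a using Quot.ind with
  | mk a => exact congr_arg (Quot.mk _) (Category.assoc f g a)

lemma Cylinder.precompQ_id (X W : C) : E.precompQ (𝟙 X) W = id := by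
  funext a
  induction a using Quot.ind with
  | mk a => exact congr_arg (Quot.mk _) (Category.id_comp a)

lemma Cylinder.Homotopy.precompQ_eq {X Y : C} {f g : X ⟶ Y} (h : E.Homotopy f g) (W : C) :
    E.precompQ f W = E.precompQ g W := by
  funext a
  induction a using Quot.ind with
  | mk a => exact Quot.sound (h.postcomp a)

lemma IsWeakEq.id (X : C) : IsWeakEq E An (𝟙 X) := fun W _ => by
  rw [Cylinder.precompQ_id]
  exact Function.bijective_id

lemma IsWeakEq.comp {X Y Z : C} {f : X ⟶ Y} {g : Y ⟶ Z} (hf : IsWeakEq E An f)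
    (hg : IsWeakEq E An g) : IsWeakEq E An (f ≫ g) := fun W hW => by
  rw [Cylinder.precompQ_comp]
  exact (hf W hW).comp (hg W hW)

lemma IsWeakEq.cancel_left {X Y Z : C} {f : X ⟶ Y} {g : Y ⟶ Z} (hf : IsWeakEq E An f)
    (hfg : IsWeakEq E An (f ≫ g)) : IsWeakEq E An g := fun W hW => by
  have h := hfg W hW
  rw [Cylinder.precompQ_comp] at h
  exact (Function.Bijective.of_comp_iff' (hf W hW) _).1 h

lemma IsWeakEq.cancel_right {X Y Z : C} {f : X ⟶ Y} {g : Y ⟶ Z} (hg : IsWeakEq E An g)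
    (hfg : IsWeakEq E An (f ≫ g)) : IsWeakEq E An f := fun W hW => by
  have h := hfg W hW
  rw [Cylinder.precompQ_comp] at h
  exact (Function.Bijective.of_comp_iff _ (hg W hW)).1 h

lemma IsWeakEq.of_two_of_six {X Y Z T : C} {f : X ⟶ Y} {g : Y ⟶ Z} {h : Z ⟶ T}
    (hfg : IsWeakEq E An (f ≫ g)) (hgh : IsWeakEq E An (g ≫ h)) : IsWeakEq E An f := by
  refine IsWeakEq.cancel_right (fun W hW => ⟨?_, ?_⟩) hfg
  · have := (hfg W hW).1
    rw [Cylinder.precompQ_comp] at this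
    exact this.of_comp
  · have := (hgh W hW).2
    rw [Cylinder.precompQ_comp] at this
    exact this.of_comp

lemma IsWeakEq.of_retract {X Y X' Y' : C} {f : X ⟶ Y} {f' : X' ⟶ Y'} (hr : IsRetractOf f f')
    (hf' : IsWeakEq E An f') : IsWeakEq E An f := fun W hW => by
  obtain ⟨i, r, j, s, hir, hjs, hi, hs⟩ := hr
  have e₁ : E.precompQ i W ∘ E.precompQ r W = _root_.id := by
    rw [← Cylinder.precompQ_comp, hir, Cylinder.precompQ_id]
  have e₂ : E.precompQ j W ∘ E.precompQ s W = _root_.id := by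
    rw [← Cylinder.precompQ_comp, hjs, Cylinder.precompQ_id]
  have e₃ : E.precompQ i W ∘ E.precompQ f' W = E.precompQ f W ∘ E.precompQ j W := by
    rw [← Cylinder.precompQ_comp, hi, Cylinder.precompQ_comp]
  have e₄ : E.precompQ f' W ∘ E.precompQ s W = E.precompQ r W ∘ E.precompQ f W := by
    rw [← Cylinder.precompQ_comp, hs, Cylinder.precompQ_comp]
  constructor
  · have h : Function.Injective (E.precompQ r W ∘ E.precompQ f W) := by
      rw [← e₄]
      exact (hf' W hW).1.comp (Function.LeftInverse.injective (congr_fun e₂))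
    exact h.of_comp
  · have h : Function.Surjective (E.precompQ f W ∘ E.precompQ j W) := by
      rw [← e₃]
      have hs : Function.Surjective (E.precompQ i W) :=
        Function.RightInverse.surjective (g := E.precompQ r W) (congr_fun e₁)
      exact hs.comp (hf' W hW).2
    exact h.of_comp

lemma CylinderLifting.isWeakEq_of_rlp (H : CylinderLifting E L An) {X Y : C} {p : X ⟶ Y}
    (hp : L.rlp p) : IsWeakEq E An p := fun W _ => by
  obtain ⟨s, hs⟩ := H.exists_lift p hp (𝟙 Y)
  obtain ⟨h, h₀, h₁, -⟩ := H.exists_lift_cylinder p hp (p ≫ s) (𝟙 X) (E.pr X ≫ p)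
    (by rw [E.i₀_pr_assoc, Category.assoc, hs, Category.comp_id])
    (by rw [E.i₁_pr_assoc, Category.id_comp])
  have hh : E.Homotopy (p ≫ s) (𝟙 X) := E.homotopy_iff.2 ⟨h, h₀, h₁⟩
  have e₁ : E.precompQ p W ∘ E.precompQ s W = id := by
    rw [← Cylinder.precompQ_comp, hh.precompQ_eq, Cylinder.precompQ_id]
  have e₂ : E.precompQ s W ∘ E.precompQ p W = id := by
    rw [← Cylinder.precompQ_comp, hs, Cylinder.precompQ_id]
  exact ⟨Function.LeftInverse.injective (congr_fun e₂),
    Function.RightInverse.surjective (congr_fun e₁)⟩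

variable [HasTerminal C]

lemma CylinderLifting.isWeakEq_of_anodyne (H : CylinderLifting E L An) {X Y : C} {i : X ⟶ Y}
    (hi : An i) : IsWeakEq E An i := fun W hW => by
  constructor
  · intro a b hab
    induction a using Quot.ind with
    | mk a =>
    induction b using Quot.ind with
    | mk b =>
    obtain ⟨h, h₀, h₁⟩ := E.homotopy_iff.1 ((H.mk_eq_mk_iff hW).1 hab)
    obtain ⟨K, hK₀, hK₁, -⟩ := H.exists_extension i hi (terminal.from W)
      ((isFibrantObj_iff_terminal An W).1 hW) a b h (terminal.from _) h₀ h₁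
      (Subsingleton.elim _ _) (Subsingleton.elim _ _) (Subsingleton.elim _ _)
    exact Quot.sound ⟨K, hK₀, hK₁⟩
  · intro a
    induction a using Quot.ind with
    | mk a =>
    obtain ⟨b, rfl⟩ := hW i hi a
    exact ⟨Quot.mk _ b, rfl⟩

lemma CylinderLifting.rlp_of_isWeakEq (H : CylinderLifting E L An) {X Y : C} {q : X ⟶ Y}
    (hq : An.rlp q) (hY : IsFibrantObj An Y) (hw : IsWeakEq E An q) : L.rlp q := by
  have hX : IsFibrantObj An X := by
    rw [isFibrantObj_iff_terminal] at hY ⊢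
    rw [Subsingleton.elim (terminal.from X) (q ≫ terminal.from Y)]
    exact An.rlp.comp_mem _ _ hq hY
  obtain ⟨t₀, ht₀⟩ := (hw X hX).2 (Quot.mk _ (𝟙 X))
  induction t₀ using Quot.ind with
  | mk t₀ =>
  replace ht₀ : E.Homotopy (q ≫ t₀) (𝟙 X) := (H.mk_eq_mk_iff hX).1 ht₀
  have ht₁ : E.Homotopy (𝟙 Y) (t₀ ≫ q) := by
    refine (H.mk_eq_mk_iff hY).1 ((hw Y hY).1 (Quot.sound ?_))
    have := H.homotopy_symm hY (ht₀.postcomp q)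
    simpa using this
  obtain ⟨b, hb₀, hb₁⟩ := E.homotopy_iff.1 ht₁
  obtain ⟨h, hh₁, hhq⟩ := H.exists_lift_end q hq t₀ b hb₁
  obtain ⟨t, ht⟩ : ∃ t, t = E.i₀ Y ≫ h := ⟨_, rfl⟩
  have htq : t ≫ q = 𝟙 Y := by rw [ht, Category.assoc, hhq, hb₀]
  have ht₂ : E.Homotopy (𝟙 X) (q ≫ t) := by
    refine H.homotopy_of_homotopy hX (H.homotopy_symm hX ht₀) ?_
    refine E.homotopy_iff.2 ⟨E.I.map q ≫ h, ?_, ?_⟩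
    · rw [← E.i₀_naturality_assoc, ht]
    · rw [← E.i₁_naturality_assoc, hh₁]
  obtain ⟨g, hg₀, hg₁⟩ := E.homotopy_iff.1 ht₂
  obtain ⟨e, he₀, he₁, heq⟩ := H.exists_face q hq g (g ≫ q ≫ t) (E.pr X ≫ q ≫ t)
    (E.I.map (E.pr X) ≫ g ≫ q)
    (by rw [E.i₀_pr_assoc, hg₁])
    (by rw [E.i₁_pr_assoc, reassoc_of% hg₁, reassoc_of% htq])
    (by rw [← Functor.map_comp_assoc, E.i₀_pr, E.I.map_id, Category.id_comp])
    (by rw [← Functor.map_comp_assoc, E.i₁_pr, E.I.map_id]; simp [htq])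
    (by rw [← E.i₁_naturality_assoc, reassoc_of% hg₁]; simp)
  rw [hg₀] at he₀
  rw [reassoc_of% hg₀] at he₁
  rw [← E.i₀_naturality_assoc, reassoc_of% hg₀] at heq
  intro K M k hk
  refine ⟨fun {a y} sq => ?_⟩
  obtain ⟨G, hG₁, hGk, hGq⟩ := H.exists_lift_box k hk q hq (y ≫ t) (E.I.map a ≫ e) (E.pr M ≫ y)
    (by rw [← E.i₁_naturality_assoc, he₁, reassoc_of% sq.w])
    (by rw [E.i₁_pr_assoc, Category.assoc, htq, Category.comp_id])
    (by rw [E.pr_naturality_assoc, Category.assoc, heq, E.pr_naturality_assoc, sq.w])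
  refine ⟨⟨⟨E.i₀ M ≫ G, ?_, ?_⟩⟩⟩
  · rw [E.i₀_naturality_assoc, hGk, ← E.i₀_naturality_assoc, he₀, Category.comp_id]
  · rw [Category.assoc, hGq, E.i₀_pr_assoc]

end

section

variable {E : Cylinder C} {L An : MorphismProperty C} [HasTerminal C]

lemma exists_anodyne_replacement (hAn : ∀ {X Y : C} (f : X ⟶ Y),
      ∃ (Z : C) (i : X ⟶ Z) (p : Z ⟶ Y), An i ∧ An.rlp p ∧ i ≫ p = f)
    {A B : C} (i : A ⟶ B) : ∃ (A' B' : C) (jA : A ⟶ A') (jB : B ⟶ B') (q : A' ⟶ B'),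
      An jA ∧ An jB ∧ An.rlp q ∧ IsFibrantObj An B' ∧ jA ≫ q = i ≫ jB := by
  obtain ⟨B', jB, t, hjB, ht, -⟩ := hAn (terminal.from B)
  obtain ⟨A', jA, q, hjA, hq, fac⟩ := hAn (i ≫ jB)
  refine ⟨A', B', jA, jB, q, hjA, hjB, hq, ?_, fac⟩
  rw [isFibrantObj_iff_terminal, Subsingleton.elim (terminal.from B') t]
  exact ht

lemma CylinderLifting.hasLiftingProperty_of_isWeakEq (H : CylinderLifting E L An)
    (hAn : ∀ {X Y : C} (f : X ⟶ Y),
      ∃ (Z : C) (i : X ⟶ Z) (p : Z ⟶ Y), An i ∧ An.rlp p ∧ i ≫ p = f)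
    {A B X Y : C} {i : A ⟶ B} {p : X ⟶ Y} (hi : L i) (hw : IsWeakEq E An i) (hp : An.rlp p)
    (hY : IsFibrantObj An Y) : HasLiftingProperty i p := by
  obtain ⟨A', B', jA, jB, q, hjA, hjB, hq, hB', fac⟩ := exists_anodyne_replacement hAn i
  have hqw : IsWeakEq E An q := by
    refine (H.isWeakEq_of_anodyne hjA).cancel_left ?_
    rw [fac]
    exact hw.comp (H.isWeakEq_of_anodyne hjB)
  have := H.rlp_of_isWeakEq hq hB' hqw i hi
  have sq₁ : CommSq jA i q jB := ⟨fac⟩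
  refine ⟨fun {a y} sq => ?_⟩
  obtain ⟨y', hy'⟩ := hY jB hjB y
  have := hp jA hjA
  have sq₂ : CommSq a jA p (q ≫ y') := ⟨by rw [reassoc_of% fac, hy', sq.w]⟩
  refine ⟨⟨⟨sq₁.lift ≫ sq₂.lift, ?_, ?_⟩⟩⟩
  · rw [sq₁.fac_left_assoc, sq₂.fac_left]
  · rw [Category.assoc, sq₂.fac_right, sq₁.fac_right_assoc, hy']

lemma CylinderLifting.isWeakEq_of_hasLiftingProperty (H : CylinderLifting E L An)
    (hAn : ∀ {X Y : C} (f : X ⟶ Y),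
      ∃ (Z : C) (i : X ⟶ Z) (p : Z ⟶ Y), An i ∧ An.rlp p ∧ i ≫ p = f)
    {A B : C} {i : A ⟶ B} (hi : ∀ {X Y : C} (p : X ⟶ Y), An.rlp p → IsFibrantObj An Y →
      HasLiftingProperty i p) : IsWeakEq E An i := by
  obtain ⟨A', B', jA, jB, q, hjA, hjB, hq, hB', fac⟩ := exists_anodyne_replacement hAn i
  have := hi q hq hB'
  have sq₁ : CommSq jA i q jB := ⟨fac⟩
  refine IsWeakEq.of_two_of_six (g := sq₁.lift) (h := q) ?_ ?_
  · rw [sq₁.fac_left]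
    exact H.isWeakEq_of_anodyne hjA
  · rw [sq₁.fac_right]
    exact H.isWeakEq_of_anodyne hjB

end

lemma exists_factorization (κ₀ : Cardinal.{v}) [Fact κ₀.IsRegular]
    [IsCardinalLocallyPresentable C κ₀] (I : MorphismProperty C) [MorphismProperty.IsSmall.{v} I]
    {X Y : C} (f : X ⟶ Y) : ∃ (Z : C) (i : X ⟶ Z) (p : Z ⟶ Y), I.rlp.llp i ∧ I.rlp p ∧ i ≫ p = f := by
  have := hasSmallObjectArgument κ₀ I
  let d := MorphismProperty.factorizationData I.rlp.llp I.rlp f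
  exact ⟨d.Z, d.i, d.p, d.hi, d.hp, d.fac⟩

/-- The trivial cofibrations of a cylinder form the left class of a weak factorization system
generated by a small set. -/
lemma CylinderLifting.exists_generating_trivialCofibrations [HasTerminal C] (κ₀ : Cardinal.{v})
    [Fact κ₀.IsRegular] [IsCardinalLocallyPresentable C κ₀] (I Λ : MorphismProperty C)
    [MorphismProperty.IsSmall.{v} I] [MorphismProperty.IsSmall.{v} Λ] {E : Cylinder C}
    (H : CylinderLifting E I.rlp.llp Λ.rlp.llp) :
    ∃ (J : MorphismProperty C) (_ : MorphismProperty.IsSmall.{v} J),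
      (∀ {A B : C} (i : A ⟶ B), J.rlp.llp i ↔ I.rlp.llp i ∧ IsWeakEq E Λ.rlp.llp i) ∧
      ∀ {X Y : C} (p : X ⟶ Y), I.rlp p ↔ J.rlp p ∧ IsWeakEq E Λ.rlp.llp p := by
  have hAn : ∀ {X Y : C} (f : X ⟶ Y), ∃ (Z : C) (i : X ⟶ Z) (p : Z ⟶ Y),
      Λ.rlp.llp i ∧ Λ.rlp.llp.rlp p ∧ i ≫ p = f := by
    intro X Y f
    rw [MorphismProperty.rlp_llp_rlp]
    exact exists_factorization κ₀ Λ f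
  have hI := H.le
  obtain ⟨S, _, hS₁, hS₂⟩ := exists_solution_set κ₀ I Λ
  have hS (x : S.toSet) : IsWeakEq E Λ.rlp.llp x.1.hom := by
    obtain ⟨A', B', jA, jB, s, q, hjA, hjB, h₁, h₂⟩ := hS₁ x.1.hom x.2
    refine IsWeakEq.of_two_of_six (g := s) (h := q) ?_ ?_
    · rw [h₁]
      exact H.isWeakEq_of_anodyne hjA
    · rw [h₂]
      exact H.isWeakEq_of_anodyne hjB
  choose Z l r hl hr fac using fun x : S.toSet => exists_factorization κ₀ I x.1.hom
  have hrL {X Y : C} {p : X ⟶ Y} (hp : I.rlp p) : IsWeakEq E Λ.rlp.llp p :=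
    H.isWeakEq_of_rlp (by rwa [MorphismProperty.rlp_llp_rlp])
  have hlw (x : S.toSet) : IsWeakEq E Λ.rlp.llp (l x) := by
    refine (hrL (hr x)).cancel_right ?_
    rw [fac]
    exact hS x
  let J : MorphismProperty C := MorphismProperty.ofHoms l
  have hJI : J ≤ I.rlp.llp := by
    rintro _ _ _ ⟨x⟩
    exact hl x
  have hIJ : I.rlp ≤ J.rlp := by
    rwa [← MorphismProperty.le_llp_iff_le_rlp]
  have hJ₁ {A B : C} (i : A ⟶ B) (hi : J.rlp.llp i) : I.rlp.llp i ∧ IsWeakEq E Λ.rlp.llp i := by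
    refine ⟨MorphismProperty.antitone_llp hIJ i hi, ?_⟩
    refine H.isWeakEq_of_hasLiftingProperty hAn fun p hp hY => hi p ?_
    rintro _ _ _ ⟨x⟩
    exact H.hasLiftingProperty_of_isWeakEq hAn (hl x) (hlw x) hp hY
  have hJ₂ {X Y : C} (p : X ⟶ Y) (hp : J.rlp p) (hw : IsWeakEq E Λ.rlp.llp p) : I.rlp p := by
    obtain ⟨T, i, q, hi, hq, fac'⟩ := exists_factorization κ₀ I p
    have hiw : IsWeakEq E Λ.rlp.llp i := by
      refine (hrL hq).cancel_right ?_
      rwa [fac']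
    intro K M k hk
    refine ⟨fun {a b} sq => ?_⟩
    have := hq k hk
    have sq₁ : CommSq (a ≫ i) k q b := ⟨by rw [Category.assoc, fac', sq.w]⟩
    obtain ⟨x, α, β, hx, hαβ⟩ := hS₂ i (fun p hp hY =>
      H.hasLiftingProperty_of_isWeakEq hAn hi hiw (by rwa [MorphismProperty.rlp_llp_rlp])
        (by rwa [isFibrantObj_iff_terminal, MorphismProperty.rlp_llp_rlp])) k hk
      (Arrow.homMk a sq₁.lift sq₁.fac_left.symm)
    have e₁ : α.left ≫ β.left = a := congr_arg CommaMorphism.left hαβ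
    have e₂ : α.right ≫ β.right = sq₁.lift := congr_arg CommaMorphism.right hαβ
    have wα : α.left ≫ x.hom = k ≫ α.right := α.w
    have wβ : β.left ≫ i = x.hom ≫ β.right := β.w
    let x' : S.toSet := ⟨x, hx⟩
    have := hr x' k hk
    have sq₂ : CommSq (α.left ≫ l x') k (r x') α.right :=
      ⟨by rw [Category.assoc, fac x']; exact wα⟩
    have := hp (l x') ⟨x'⟩
    have sq₃ : CommSq β.left (l x') p (r x' ≫ β.right ≫ q) :=
      ⟨by rw [← fac', reassoc_of% wβ, reassoc_of% (fac x')]⟩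
    refine ⟨⟨⟨sq₂.lift ≫ sq₃.lift, ?_, ?_⟩⟩⟩
    · rw [sq₂.fac_left_assoc, Category.assoc, sq₃.fac_left, e₁]
    · rw [Category.assoc, sq₃.fac_right, sq₂.fac_right_assoc, reassoc_of% e₂, sq₁.fac_right]
  refine ⟨J, inferInstance, fun i => ⟨hJ₁ i, fun ⟨hi, hw⟩ => ?_⟩,
    fun p => ⟨fun hp => ⟨hIJ p hp, hrL hp⟩, fun ⟨hp, hw⟩ => hJ₂ p hp hw⟩⟩
  obtain ⟨T, j, p, hj, hp, fac'⟩ := exists_factorization κ₀ J i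
  have hpw : IsWeakEq E Λ.rlp.llp p := by
    refine (hJ₁ j hj).2.cancel_left ?_
    rwa [fac']
  have := hi p (hJ₂ p hp hpw)
  exact J.rlp.llp.of_retract (RetractArrow.ofLeftLiftingProperty fac') hj

/-- A retract in the explicit sense as a retract in the category of arrows. -/
lemma IsRetractOf.nonempty_retractArrow {X Y X' Y' : C} {f : X ⟶ Y} {f' : X' ⟶ Y'}
    (h : IsRetractOf f f') : Nonempty (RetractArrow f f') := by
  obtain ⟨i, r, j, s, hir, hjs, hi, hs⟩ := h
  exact ⟨{ i := Arrow.homMk i j hi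
           r := Arrow.homMk r s hs.symm
           retract := by ext <;> assumption }⟩

/-- The model structure determined by a cylinder and small generating sets of cofibrations and of
anodyne extensions. -/
theorem CylinderLifting.exists_modelStructure [HasTerminal C] (κ₀ : Cardinal.{v})
    [Fact κ₀.IsRegular] [IsCardinalLocallyPresentable C κ₀] (I Λ : MorphismProperty C)
    [MorphismProperty.IsSmall.{v} I] [MorphismProperty.IsSmall.{v} Λ] {E : Cylinder C}
    (H : CylinderLifting E I.rlp.llp Λ.rlp.llp) :
    ∃ M : ModelStructure C, M.cof = I.rlp.llp ∧
      ∀ W, M.Fibrant W ↔ IsFibrantObj Λ.rlp.llp W := by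
  obtain ⟨J, _, hJ, hI⟩ := H.exists_generating_trivialCofibrations κ₀ I Λ
  have hAn : ∀ {X Y : C} (f : X ⟶ Y), ∃ (Z : C) (i : X ⟶ Z) (p : Z ⟶ Y),
      Λ.rlp.llp i ∧ Λ.rlp.llp.rlp p ∧ i ≫ p = f := by
    intro X Y f
    rw [MorphismProperty.rlp_llp_rlp]
    exact exists_factorization κ₀ Λ f
  refine ⟨{
    weq := fun _ _ f => IsWeakEq E Λ.rlp.llp f
    cof := I.rlp.llp
    fib := J.rlp
    weq_id := IsWeakEq.id
    weq_comp := fun _ _ _ _ _ => IsWeakEq.comp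
    weq_cancel_left := fun _ _ _ _ _ => IsWeakEq.cancel_left
    weq_cancel_right := fun _ _ _ _ _ => IsWeakEq.cancel_right
    weq_retract := fun _ _ _ _ _ _ => IsWeakEq.of_retract
    cof_retract := fun _ _ _ _ _ _ h h' => I.rlp.llp.of_retract h.nonempty_retractArrow.some h'
    fib_retract := fun _ _ _ _ _ _ h h' => J.rlp.of_retract h.nonempty_retractArrow.some h'
    lift_trivCof_fib := fun _ _ _ _ i p hi hw hp => (hJ i).2 ⟨hi, hw⟩ p hp
    lift_cof_trivFib := fun _ _ _ _ i p hi hp hw => hi p ((hI p).2 ⟨hp, hw⟩)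
    fact_cof_trivFib := fun _ _ f => by
      obtain ⟨Z, i, p, hi, hp, fac⟩ := exists_factorization κ₀ I f
      exact ⟨Z, i, p, hi, ((hI p).1 hp).1, ((hI p).1 hp).2, fac⟩
    fact_trivCof_fib := fun _ _ f => by
      obtain ⟨Z, i, p, hi, hp, fac⟩ := exists_factorization κ₀ J f
      exact ⟨Z, i, p, ((hJ i).1 hi).1, ((hJ i).1 hi).2, hp, fac⟩ }, rfl, fun W => ⟨?_, ?_⟩⟩
  · intro h A B i hi a
    exact h i (H.le i hi) (H.isWeakEq_of_anodyne hi) a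
  · intro h A B i hi hw a
    have := H.hasLiftingProperty_of_isWeakEq hAn hi hw ((isFibrantObj_iff_terminal _ W).1 h)
      (Y := ⊤_ C) fun _ _ _ _ _ => ⟨terminal.from _, Subsingleton.elim _ _⟩
    have sq : CommSq a i (terminal.from W) (terminal.from B) := ⟨Subsingleton.elim _ _⟩
    exact ⟨sq.lift, sq.fac_left⟩

section

variable [HasColimits C] {E : Cylinder C} {L An : MorphismProperty C}

/-- The cylinder with its ends exchanged. -/
@[simps]
def Cylinder.swap (E : Cylinder C) : Cylinder C where
  I := E.I
  d0 := E.d1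
  d1 := E.d0
  σ := E.σ
  d0_σ := E.d1_σ
  d1_σ := E.d0_σ

lemma Cylinder.exists_extension {K M X Y : C} (k : K ⟶ M) (p : X ⟶ Y)
    [HasLiftingProperty (E.boundaryBox k) p] (b₀ b₁ : M ⟶ X) (h : E.I.obj K ⟶ X)
    (b : E.I.obj M ⟶ Y) (h₀ : E.i₀ K ≫ h = k ≫ b₀) (h₁ : E.i₁ K ≫ h = k ≫ b₁)
    (h₂ : E.i₀ M ≫ b = b₀ ≫ p) (h₃ : E.i₁ M ≫ b = b₁ ≫ p) (h₄ : E.I.map k ≫ b = h ≫ p) :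
    ∃ H : E.I.obj M ⟶ X, E.i₀ M ≫ H = b₀ ∧ E.i₁ M ≫ H = b₁ ∧ H ≫ p = b := by
  have hι : ∀ X, coprod.inl ≫ E.ι X = E.i₀ X := fun X => coprod.inl_desc _ _
  have hι' : ∀ X, coprod.inr ≫ E.ι X = E.i₁ X := fun X => coprod.inr_desc _ _
  have w : coprod.map k k ≫ coprod.desc b₀ b₁ = E.ι K ≫ h := by
    apply coprod.hom_ext
    · rw [coprod.inl_map_assoc, coprod.inl_desc, reassoc_of% (hι K), h₀]
    · rw [coprod.inr_map_assoc, coprod.inr_desc, reassoc_of% (hι' K), h₁]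
  have hl : pushout.inl _ _ ≫ E.boundaryBox k = E.ι M := pushout.inl_desc _ _ _
  have hr : pushout.inr _ _ ≫ E.boundaryBox k = E.I.map k := pushout.inr_desc _ _ _
  have sq : CommSq (pushout.desc (coprod.desc b₀ b₁) h w) (E.boundaryBox k) p b := by
    refine ⟨?_⟩
    apply pushout.hom_ext
    · rw [reassoc_of% hl, pushout.inl_desc_assoc]
      apply coprod.hom_ext
      · rw [coprod.inl_desc_assoc, reassoc_of% (hι M), h₂]
      · rw [coprod.inr_desc_assoc, reassoc_of% (hι' M), h₃]
    · rw [reassoc_of% hr, pushout.inr_desc_assoc, h₄]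
  have hL : E.ι M ≫ sq.lift = coprod.desc b₀ b₁ := by
    rw [← hl, Category.assoc, sq.fac_left, pushout.inl_desc]
  refine ⟨sq.lift, ?_, ?_, sq.fac_right⟩
  · rw [← hι, Category.assoc, hL, coprod.inl_desc]
  · rw [← hι', Category.assoc, hL, coprod.inr_desc]

lemma Cylinder.exists_lift_box {K M X Y : C} (k : K ⟶ M) (p : X ⟶ Y)
    [HasLiftingProperty (E.box1 k) p]
    (m : M ⟶ X) (h : E.I.obj K ⟶ X) (b : E.I.obj M ⟶ Y) (h₁ : k ≫ m = E.i₁ K ≫ h)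
    (h₂ : E.i₁ M ≫ b = m ≫ p) (h₃ : E.I.map k ≫ b = h ≫ p) :
    ∃ H : E.I.obj M ⟶ X, E.i₁ M ≫ H = m ∧ E.I.map k ≫ H = h ∧ H ≫ p = b := by
  have hl : pushout.inl _ _ ≫ E.box1 k = E.i₁ M := pushout.inl_desc _ _ _
  have hr : pushout.inr _ _ ≫ E.box1 k = E.I.map k := pushout.inr_desc _ _ _
  obtain ⟨g, hg, hg'⟩ : ∃ g : pushout k (E.d1.app K) ⟶ X,
      pushout.inl _ _ ≫ g = m ∧ pushout.inr _ _ ≫ g = h :=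
    ⟨pushout.desc m h h₁, pushout.inl_desc _ _ _, pushout.inr_desc _ _ _⟩
  have sq : CommSq g (E.box1 k) p b := by
    refine ⟨?_⟩
    apply pushout.hom_ext
    · rw [reassoc_of% hl, reassoc_of% hg, h₂]
    · rw [reassoc_of% hr, reassoc_of% hg', h₃]
  refine ⟨sq.lift, ?_, ?_, sq.fac_right⟩
  · rw [← hl, Category.assoc, sq.fac_left, hg]
  · rw [← hr, Category.assoc, sq.fac_left, hg']

lemma CylinderLifting.of_box1 (le : An ≤ L) (initial_mem : ∀ X : C, L (initial.to X))
    (hI : PreservesColimits E.I) (ι_mem : ∀ X : C, L (E.ι X))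
    (box1_mem : ∀ ⦃K M : C⦄ (f : K ⟶ M), L f → An (E.box1 f))
    (exists_extension : ∀ {K M X Y : C} (k : K ⟶ M) (_ : An k) (p : X ⟶ Y) (_ : An.rlp p)
      (b₀ b₁ : M ⟶ X) (h : E.I.obj K ⟶ X) (b : E.I.obj M ⟶ Y) (_ : E.i₀ K ≫ h = k ≫ b₀)
      (_ : E.i₁ K ≫ h = k ≫ b₁) (_ : E.i₀ M ≫ b = b₀ ≫ p) (_ : E.i₁ M ≫ b = b₁ ≫ p)
      (_ : E.I.map k ≫ b = h ≫ p),
      ∃ H : E.I.obj M ⟶ X, E.i₀ M ≫ H = b₀ ∧ E.i₁ M ≫ H = b₁ ∧ H ≫ p = b) :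
    CylinderLifting E L An := by
  have hι : ∀ X, coprod.inl ≫ E.ι X = E.i₀ X := fun X => coprod.inl_desc _ _
  have hι' : ∀ X, coprod.inr ≫ E.ι X = E.i₁ X := fun X => coprod.inr_desc _ _
  have hbox {K M X Y : C} (k : K ⟶ M) (hk : L k) (p : X ⟶ Y) (hp : An.rlp p)
      (m : M ⟶ X) (h : E.I.obj K ⟶ X) (b : E.I.obj M ⟶ Y) (h₁ : k ≫ m = E.i₁ K ≫ h)
      (h₂ : E.i₁ M ≫ b = m ≫ p) (h₃ : E.I.map k ≫ b = h ≫ p) :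
      ∃ H : E.I.obj M ⟶ X, E.i₁ M ≫ H = m ∧ E.I.map k ≫ H = h ∧ H ≫ p = b := by
    have := hp _ (box1_mem k hk)
    exact Cylinder.exists_lift_box k p m h b h₁ h₂ h₃
  refine
    { le := le
      exists_lift := fun {Z X Y} p hp y => ?_
      exists_lift_cylinder := fun {Z X Y} p hp x₀ x₁ b h₀ h₁ => ?_
      exists_lift_end := fun {Z X Y} p hp x b h₁ => ?_
      exists_lift_box := hbox
      exists_extension := exists_extension
      exists_lift_square := fun {Z X Y} p hp u v w b h₀ h₁ hu hv hw => ?_ }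
  · have := hp _ (initial_mem Z)
    have sq : CommSq (initial.to X) (initial.to Z) p y := ⟨Subsingleton.elim _ _⟩
    exact ⟨sq.lift, sq.fac_right⟩
  · have := hp _ (ι_mem Z)
    have sq : CommSq (coprod.desc x₀ x₁) (E.ι Z) p b := by
      refine ⟨?_⟩
      apply coprod.hom_ext
      · rw [coprod.inl_desc_assoc, reassoc_of% (hι Z), h₀]
      · rw [coprod.inr_desc_assoc, reassoc_of% (hι' Z), h₁]
    refine ⟨sq.lift, ?_, ?_, sq.fac_right⟩
    · rw [← hι, Category.assoc, sq.fac_left, coprod.inl_desc]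
    · rw [← hι', Category.assoc, sq.fac_left, coprod.inr_desc]
  · have hi : IsInitial (E.I.obj (⊥_ C)) := IsInitial.isInitialObj E.I _ initialIsInitial
    obtain ⟨H, h₁, -, h₂⟩ := hbox (initial.to Z) (initial_mem Z) p hp x (hi.to X) b
      (Subsingleton.elim _ _) h₁ (hi.hom_ext _ _)
    exact ⟨H, h₁, h₂⟩
  · have hc := mapIsColimitOfPreservesOfIsColimit E.I _ _ (coprodIsCoprod Z Z)
    have ext {T : C} {f g : E.I.obj (Z ⨿ Z) ⟶ T}
        (hl : E.I.map coprod.inl ≫ f = E.I.map coprod.inl ≫ g)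
        (hr : E.I.map coprod.inr ≫ f = E.I.map coprod.inr ≫ g) : f = g :=
      BinaryCofan.IsColimit.hom_ext hc hl hr
    obtain ⟨h, hu', hv'⟩ : ∃ h : E.I.obj (Z ⨿ Z) ⟶ X,
        E.I.map coprod.inl ≫ h = u ∧ E.I.map coprod.inr ≫ h = v :=
      have ⟨h, hu', hv'⟩ := BinaryCofan.IsColimit.desc' hc u v
      ⟨h, hu', hv'⟩
    have mι : E.I.map coprod.inl ≫ E.I.map (E.ι Z) = E.I.map (E.i₀ Z) := by
      rw [← E.I.map_comp, hι]
    have mι' : E.I.map coprod.inr ≫ E.I.map (E.ι Z) = E.I.map (E.i₁ Z) := by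
      rw [← E.I.map_comp, hι']
    obtain ⟨H, hH₁, hH₂, hH₃⟩ := hbox (E.ι Z) (ι_mem Z) p hp w h b
      (by
        apply coprod.hom_ext
        · rw [reassoc_of% (hι Z), E.i₁_naturality_assoc, hu', h₀]
        · rw [reassoc_of% (hι' Z), E.i₁_naturality_assoc, hv', h₁]) hw
      (by
        apply ext
        · rw [reassoc_of% mι, reassoc_of% hu', hu]
        · rw [reassoc_of% mι', reassoc_of% hv', hv])
    refine ⟨H, ?_, ?_, hH₃⟩
    · rw [← mι, Category.assoc, hH₂, hu']
    · rw [← mι', Category.assoc, hH₂, hv']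

lemma IsRightAnodyneClass.cylinderLifting (hE : IsExactCylinder E L)
    (hL : ∀ X : C, L (initial.to X)) (hAn : IsRightAnodyneClass E L An) :
    CylinderLifting E L An :=
  .of_box1 hAn.le hL hE.preservesColimits hE.ι_mem hAn.box1_mem
    fun k hk p hp b₀ b₁ h b h₀ h₁ h₂ h₃ h₄ =>
      have := hp _ (hAn.boundaryBox_mem k hk)
      Cylinder.exists_extension k p b₀ b₁ h b h₀ h₁ h₂ h₃ h₄

lemma IsLeftAnodyneClass.cylinderLifting [L.RespectsIso] (hE : IsExactCylinder E L)
    (hL : ∀ X : C, L (initial.to X)) (hAn : IsLeftAnodyneClass E L An) :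
    CylinderLifting E.swap L An := by
  refine .of_box1 hAn.le hL hE.preservesColimits (fun X => ?_) hAn.box0_mem
    fun k hk p hp b₀ b₁ h b h₀ h₁ h₂ h₃ h₄ => ?_
  · have : (coprod.braiding X X).hom ≫ E.ι X = (show X ⨿ X ⟶ E.I.obj X from E.swap.ι X) := by
      have h₀ : coprod.inl ≫ E.ι X = E.i₀ X := coprod.inl_desc _ _
      have h₁ : coprod.inr ≫ E.ι X = E.i₁ X := coprod.inr_desc _ _
      have h₀' : coprod.inl ≫ E.swap.ι X = E.i₁ X := coprod.inl_desc _ _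
      have h₁' : coprod.inr ≫ E.swap.ι X = E.i₀ X := coprod.inr_desc _ _
      apply coprod.hom_ext
      · rw [coprod.braiding_hom, coprod.inl_desc_assoc, h₁]
        exact h₀'.symm
      · rw [coprod.braiding_hom, coprod.inr_desc_assoc, h₀]
        exact h₁'.symm
    change L (show X ⨿ X ⟶ E.I.obj X from E.swap.ι X)
    rw [← this]
    exact MorphismProperty.RespectsIso.precomp L _ _ (hE.ι_mem X)
  · have := hp _ (hAn.boundaryBox_mem k hk)
    obtain ⟨H, e₁, e₂, e₃⟩ := Cylinder.exists_extension (E := E) k p b₁ b₀ h b h₁ h₀ h₃ h₂ h₄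
    exact ⟨H, e₂, e₁, e₃⟩

end

section

variable (A : C)

lemma overProp_rlp (W : MorphismProperty C) : (overProp W A).rlp = overProp W.rlp A := by
  ext X Y p
  constructor
  · intro hp K M k hk
    refine ⟨fun {a b} sq => ?_⟩
    let k' : Over.mk (k ≫ b ≫ Y.hom) ⟶ Over.mk (b ≫ Y.hom) := Over.homMk k
    let a' : Over.mk (k ≫ b ≫ Y.hom) ⟶ X := Over.homMk a (by
      change a ≫ X.hom = k ≫ b ≫ Y.hom
      rw [← sq.w_assoc, Over.w])
    let b' : Over.mk (b ≫ Y.hom) ⟶ Y := Over.homMk b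
    have := hp k' hk
    have sq' : CommSq a' k' p b' := ⟨Over.OverMorphism.ext sq.w⟩
    exact ⟨⟨⟨sq'.lift.left, congr_arg CommaMorphism.left sq'.fac_left,
      congr_arg CommaMorphism.left sq'.fac_right⟩⟩⟩
  · intro hp K M k hk
    have := hp k.left hk
    exact HasLiftingProperty.over k p

lemma overProp_rlp_llp {W : MorphismProperty C} (hW : ∀ {X Y : C} (f : X ⟶ Y),
      ∃ (Z : C) (i : X ⟶ Z) (p : Z ⟶ Y), W.rlp.llp i ∧ W.rlp p ∧ i ≫ p = f) :
    (overProp W A).rlp.llp = overProp W.rlp.llp A := by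
  rw [overProp_rlp]
  ext X Y i
  constructor
  · intro hi
    obtain ⟨Z, j, p, hj, hp, fac⟩ := hW i.left
    let p' : Over.mk (p ≫ Y.hom) ⟶ Y := Over.homMk p
    let j' : X ⟶ Over.mk (p ≫ Y.hom) := Over.homMk j (by
      change j ≫ p ≫ Y.hom = X.hom
      rw [reassoc_of% fac, Over.w])
    have := hi p' hp
    have fac' : j' ≫ p' = i := Over.OverMorphism.ext fac
    exact W.rlp.llp.of_retract
      ((RetractArrow.ofLeftLiftingProperty fac').map (Over.forget A)) hj
  · intro hi K M p hp
    have := hi p.left hp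
    exact HasLiftingProperty.over i p

lemma isSmall_overProp (W : MorphismProperty C) [MorphismProperty.IsSmall.{v} W] :
    MorphismProperty.IsSmall.{v} (overProp W A) := by
  let φ (x : Σ w : W.toSet, (w.1.right ⟶ A)) : (overProp W A).toSet :=
    ⟨Arrow.mk (Over.homMk x.1.1.hom : Over.mk (x.1.1.hom ≫ x.2) ⟶ Over.mk x.2), x.1.2⟩
  refine ⟨small_of_surjective (f := φ) ?_⟩
  rintro ⟨⟨X, Y, f⟩, hf⟩
  change W f.left at hf
  have e {K M : C} (k : K ⟶ M) {p : K ⟶ A} {q : M ⟶ A} (h : k ≫ q = p) :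
      Arrow.mk (Over.homMk k : Over.mk (k ≫ q) ⟶ Over.mk q) =
        Arrow.mk (Over.homMk k h : Over.mk p ⟶ Over.mk q) := by
    subst h
    rfl
  exact ⟨⟨⟨Arrow.mk f.left, hf⟩, Y.hom⟩, Subtype.ext (e f.left (Over.w f))⟩

lemma isFibrantObj_overProp (An : MorphismProperty C) (X : Over A) :
    IsFibrantObj (overProp An A) X ↔ IsFib An X.hom := by
  constructor
  · intro h K M k hk
    refine ⟨fun {a b} sq => ?_⟩
    let k' : Over.mk (k ≫ b) ⟶ Over.mk b := Over.homMk k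
    let a' : Over.mk (k ≫ b) ⟶ X := Over.homMk a sq.w
    obtain ⟨c, hc⟩ := h k' hk a'
    exact ⟨⟨⟨c.left, congr_arg CommaMorphism.left hc, Over.w c⟩⟩⟩
  · intro h K M k hk a
    have := h k.left hk
    have sq : CommSq a.left k.left X.hom M.hom := ⟨by rw [Over.w, Over.w]⟩
    exact ⟨Over.homMk sq.lift sq.fac_right, Over.OverMorphism.ext sq.fac_left⟩

/-- The cylinder induced on a slice. -/
def Cylinder.over (E : Cylinder C) : Cylinder (Over A) where
  I :=
    { obj := fun X => Over.mk (E.pr X.left ≫ X.hom)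
      map := fun {X Y} f => Over.homMk (E.I.map f.left) (by
        change E.I.map f.left ≫ E.pr Y.left ≫ Y.hom = E.pr X.left ≫ X.hom
        rw [E.pr_naturality_assoc, Over.w])
      map_id := fun X => Over.OverMorphism.ext (E.I.map_id _)
      map_comp := fun f g => Over.OverMorphism.ext (E.I.map_comp _ _) }
  d0 :=
    { app := fun X => Over.homMk (E.i₀ X.left) (E.i₀_pr_assoc _ _)
      naturality := fun X Y f => Over.OverMorphism.ext (E.i₀_naturality _) }
  d1 :=
    { app := fun X => Over.homMk (E.i₁ X.left) (E.i₁_pr_assoc _ _)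
      naturality := fun X Y f => Over.OverMorphism.ext (E.i₁_naturality _) }
  σ :=
    { app := fun X => Over.homMk (E.pr X.left) rfl
      naturality := fun X Y f => Over.OverMorphism.ext (E.pr_naturality _) }
  d0_σ := fun X => Over.OverMorphism.ext (E.i₀_pr _)
  d1_σ := fun X => Over.OverMorphism.ext (E.i₁_pr _)

lemma exists_over_lift {Z X Y : Over A} (p : X ⟶ Y) (b : Z ⟶ Y) (h : Z.left ⟶ X.left)
    (w : h ≫ p.left = b.left) : ∃ h' : Z ⟶ X, h'.left = h ∧ h' ≫ p = b :=
  ⟨Over.homMk h (by rw [← Over.w p, reassoc_of% w, Over.w]), rfl, Over.OverMorphism.ext w⟩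

lemma CylinderLifting.over {E : Cylinder C} {L An : MorphismProperty C}
    (H : CylinderLifting E L An) : CylinderLifting (E.over A) (overProp L A) (overProp An A) := by
  have e {X Y : Over A} {f g : X ⟶ Y} (h : f = g) : f.left = g.left :=
    congr_arg CommaMorphism.left h
  have hL {X Y : Over A} {p : X ⟶ Y} (hp : (overProp L A).rlp p) : L.rlp p.left := by
    rwa [overProp_rlp] at hp
  have hAn {X Y : Over A} {p : X ⟶ Y} (hp : (overProp An A).rlp p) : An.rlp p.left := by
    rwa [overProp_rlp] at hp
  refine
    { le := fun _ _ f hf => H.le _ hf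
      exists_lift := fun {Z X Y} p hp y => ?_
      exists_lift_cylinder := fun {Z X Y} p hp x₀ x₁ b h₀ h₁ => ?_
      exists_lift_end := fun {Z X Y} p hp x b h₁ => ?_
      exists_lift_box := fun {K M X Y} k hk p hp m h b h₁ h₂ h₃ => ?_
      exists_extension := fun {K M X Y} k hk p hp b₀ b₁ h b h₀ h₁ h₂ h₃ h₄ => ?_
      exists_lift_square := fun {Z X Y} p hp u v w b h₀ h₁ hu hv hw => ?_ }
  · obtain ⟨x, hx⟩ := H.exists_lift p.left (hL hp) y.left
    obtain ⟨x', -, hx'⟩ := exists_over_lift A p y x hx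
    exact ⟨x', hx'⟩
  · obtain ⟨g, hg₀, hg₁, hg⟩ := H.exists_lift_cylinder p.left (hL hp) x₀.left x₁.left b.left
      (e h₀) (e h₁)
    obtain ⟨g', rfl, hg'⟩ := exists_over_lift A p b g hg
    exact ⟨g', Over.OverMorphism.ext hg₀, Over.OverMorphism.ext hg₁, hg'⟩
  · obtain ⟨g, hg₁, hg⟩ := H.exists_lift_end p.left (hAn hp) x.left b.left (e h₁)
    obtain ⟨g', rfl, hg'⟩ := exists_over_lift A p b g hg
    exact ⟨g', Over.OverMorphism.ext hg₁, hg'⟩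
  · obtain ⟨g, hg₁, hg₂, hg⟩ := H.exists_lift_box k.left hk p.left (hAn hp) m.left h.left b.left
      (e h₁) (e h₂) (e h₃)
    obtain ⟨g', rfl, hg'⟩ := exists_over_lift A p b g hg
    exact ⟨g', Over.OverMorphism.ext hg₁, Over.OverMorphism.ext hg₂, hg'⟩
  · obtain ⟨g, hg₁, hg₂, hg⟩ := H.exists_extension k.left hk p.left (hAn hp) b₀.left b₁.left
      h.left b.left (e h₀) (e h₁) (e h₂) (e h₃) (e h₄)
    obtain ⟨g', rfl, hg'⟩ := exists_over_lift A p b g hg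
    exact ⟨g', Over.OverMorphism.ext hg₁, Over.OverMorphism.ext hg₂, hg'⟩
  · obtain ⟨g, hg₁, hg₂, hg⟩ := H.exists_lift_square p.left (hAn hp) u.left v.left w.left b.left
      (e h₀) (e h₁) (e hu) (e hv) (e hw)
    obtain ⟨g', rfl, hg'⟩ := exists_over_lift A p b g hg
    exact ⟨g', Over.OverMorphism.ext hg₁, Over.OverMorphism.ext hg₂, hg'⟩

/-- The model structure on a slice whose fibrant objects are the fibrations relative to a class of
anodyne extensions. -/
theorem CylinderLifting.exists_modelStructure_over [LocallyPresentable C] {E : Cylinder C}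
    {L An : MorphismProperty C} (H : CylinderLifting E L An)
    (hL : ∃ S : Set (Arrow C), Small.{v} S ∧ L = llp (rlp (ofArrows S)))
    (hAn : ∃ S : Set (Arrow C), Small.{v} S ∧ An = llp (rlp (ofArrows S))) :
    ∃ M : ModelStructure (Over A), M.cof = overProp L A ∧
      ∀ X : Over A, M.Fibrant X ↔ IsFib An X.hom := by
  obtain ⟨S, hS, rfl⟩ := hL
  obtain ⟨T, hT, rfl⟩ := hAn
  obtain ⟨κ₀, _, _⟩ := LocallyPresentable.exists_isCardinalLocallyPresentable (C := C)
  have := isCardinalLocallyPresentable_over κ₀ A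
  have : MorphismProperty.IsSmall.{v} (ofArrows S) := ⟨hS⟩
  have : MorphismProperty.IsSmall.{v} (ofArrows T) := ⟨hT⟩
  have := isSmall_overProp A (ofArrows S)
  have := isSmall_overProp A (ofArrows T)
  have : HasTerminal (Over A) := Over.mkIdTerminal.hasTerminal
  have eS := overProp_rlp_llp A (exists_factorization κ₀ (ofArrows S))
  have eT := overProp_rlp_llp A (exists_factorization κ₀ (ofArrows T))
  have H' := H.over A
  change CylinderLifting (E.over A) (overProp (ofArrows S).rlp.llp A)
    (overProp (ofArrows T).rlp.llp A) at H'
  rw [← eS, ← eT] at H'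
  obtain ⟨M, hM, hM'⟩ := H'.exists_modelStructure κ₀
  refine ⟨M, hM.trans eS, fun X => ?_⟩
  rw [hM', eT]
  exact isFibrantObj_overProp A _ X

end

namespace ModelStructure

lemma fib_of_hasLiftingProperty (M : ModelStructure C) {X Y : C} {p : X ⟶ Y}
    (h : ∀ {K N : C} (i : K ⟶ N), M.cof i → M.weq i → HasLiftingProperty i p) : M.fib p := by
  obtain ⟨Z, i, q, hi, hw, hq, fac⟩ := M.fact_trivCof_fib p
  have := h i hi hw
  have sq : CommSq (𝟙 X) i p q := ⟨by rw [fac, Category.id_comp]⟩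
  exact M.fib_retract p q ⟨i, sq.lift, 𝟙 Y, 𝟙 Y, sq.fac_left, Category.id_comp _,
    by rw [fac, Category.comp_id], by rw [sq.fac_right, Category.comp_id]⟩ hq

lemma fib_iff (M : ModelStructure C) {X Y : C} (p : X ⟶ Y) :
    M.fib p ↔ ∀ {K N : C} (i : K ⟶ N), M.cof i → M.weq i → HasLiftingProperty i p :=
  ⟨fun hp _ _ i hi hw => M.lift_trivCof_fib i p hi hw hp, M.fib_of_hasLiftingProperty⟩

lemma trivFib_iff (M : ModelStructure C) {X Y : C} (p : X ⟶ Y) :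
    M.fib p ∧ M.weq p ↔ ∀ {K N : C} (i : K ⟶ N), M.cof i → HasLiftingProperty i p := by
  refine ⟨fun hp _ _ i hi => M.lift_cof_trivFib i p hi hp.1 hp.2,
    fun h => ⟨M.fib_of_hasLiftingProperty fun i hi _ => h i hi, ?_⟩⟩
  obtain ⟨Z, i, q, hi, -, hw, fac⟩ := M.fact_cof_trivFib p
  have := h i hi
  have sq : CommSq (𝟙 X) i p q := ⟨by rw [fac, Category.id_comp]⟩
  exact M.weq_retract p q ⟨i, sq.lift, 𝟙 Y, 𝟙 Y, sq.fac_left, Category.id_comp _,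
    by rw [fac, Category.comp_id], by rw [sq.fac_right, Category.comp_id]⟩ hw

lemma isRetractOf_of_hasLiftingProperty {X Y Z : C} {f : X ⟶ Z} {i : X ⟶ Y} {p : Y ⟶ Z}
    (h : i ≫ p = f) [HasLiftingProperty f p] : IsRetractOf f i := by
  have sq : CommSq i f p (𝟙 Z) := ⟨by rw [h, Category.comp_id]⟩
  exact ⟨𝟙 X, 𝟙 X, sq.lift, p, Category.id_comp _, sq.fac_right,
    by rw [sq.fac_left, Category.id_comp], by rw [h, Category.id_comp]⟩

lemma cof_of_hasLiftingProperty (M : ModelStructure C) {K N : C} {i : K ⟶ N}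
    (h : ∀ {X Y : C} (p : X ⟶ Y), M.fib p → M.weq p → HasLiftingProperty i p) : M.cof i := by
  obtain ⟨Z, j, q, hj, hq, hw, fac⟩ := M.fact_cof_trivFib i
  have := h q hq hw
  exact M.cof_retract i j (isRetractOf_of_hasLiftingProperty fac) hj

lemma weq_of_hasLiftingProperty (M : ModelStructure C) {K N : C} {i : K ⟶ N}
    (h : ∀ {X Y : C} (p : X ⟶ Y), M.fib p → HasLiftingProperty i p) : M.weq i := by
  obtain ⟨Z, j, q, -, hw, hq, fac⟩ := M.fact_trivCof_fib i
  have := h q hq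
  exact M.weq_retract i j (isRetractOf_of_hasLiftingProperty fac) hw

lemma cof_pushout_inl [HasPushouts C] (M : ModelStructure C) {A B D : C} (f : A ⟶ D) {i : A ⟶ B}
    (hi : M.cof i) : M.cof (pushout.inl f i) :=
  M.cof_of_hasLiftingProperty fun p hp hw =>
    have := M.lift_cof_trivFib i p hi hp hw
    (IsPushout.of_hasPushout f i).hasLiftingProperty p

lemma weq_pushout_inl [HasPushouts C] (M : ModelStructure C) {A B D : C} (f : A ⟶ D) {i : A ⟶ B}
    (hi : M.cof i) (hw : M.weq i) : M.weq (pushout.inl f i) :=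
  M.weq_of_hasLiftingProperty fun p hp =>
    have := M.lift_trivCof_fib i p hi hw hp
    (IsPushout.of_hasPushout f i).hasLiftingProperty p

lemma cof_comp (M : ModelStructure C) {X Y Z : C} {f : X ⟶ Y} {g : Y ⟶ Z} (hf : M.cof f)
    (hg : M.cof g) : M.cof (f ≫ g) :=
  M.cof_of_hasLiftingProperty fun p hp hw =>
    have := M.lift_cof_trivFib f p hf hp hw
    have := M.lift_cof_trivFib g p hg hp hw
    inferInstance

lemma Fibrant.of_fib {M : ModelStructure C} {X Y : C} {p : X ⟶ Y} (hp : M.fib p)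
    (hY : M.Fibrant Y) : M.Fibrant X := by
  intro K N i hi hw a
  obtain ⟨b, hb⟩ := hY i hi hw (a ≫ p)
  have := M.lift_trivCof_fib i p hi hw hp
  have sq : CommSq a i p b := ⟨hb.symm⟩
  exact ⟨sq.lift, sq.fac_left⟩

lemma fibrant_of_fib_terminal {M : ModelStructure C} {X T : C} (hT : IsTerminal T) {p : X ⟶ T}
    (hp : M.fib p) : M.Fibrant X :=
  .of_fib hp fun _ _ _ _ _ _ => ⟨hT.from _, hT.hom_ext _ _⟩

variable [HasTerminal C] [HasPushouts C]

/-- A trivial cofibration remains one in a model structure with the same cofibrations and at most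
as many fibrant objects. -/
lemma weq_of_trivCof {M M' : ModelStructure C} (hcof : M'.cof = M.cof)
    (hfib : ∀ X, M'.Fibrant X → M.Fibrant X) {A B : C} {i : A ⟶ B} (hi : M.cof i)
    (hw : M.weq i) : M'.weq i := by
  have hT {X Y : C} (p : X ⟶ Y) : M.fib p ∧ M.weq p ↔ M'.fib p ∧ M'.weq p := by
    rw [trivFib_iff, trivFib_iff, hcof]
  obtain ⟨B', jB, t₀, hjB, hjB', ht₀, -⟩ := M'.fact_trivCof_fib (terminal.from B)
  obtain ⟨A', jA, q, hjA, hjA', hq, fac⟩ := M'.fact_trivCof_fib (i ≫ jB)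
  have hB' : M'.Fibrant B' := fibrant_of_fib_terminal terminalIsTerminal ht₀
  obtain ⟨s, hs⟩ := hfib A' (.of_fib hq hB') i hi hw jA
  obtain ⟨Z, c, r, hc, hr, hrw, hcr⟩ :=
    M.fact_cof_trivFib (pushout.desc (f := i) (g := i) (𝟙 B) (𝟙 B) rfl)
  have h₀ : (pushout.inl i i ≫ c) ≫ r = 𝟙 B := by rw [Category.assoc, hcr, pushout.inl_desc]
  have hcw : M.weq c := by
    refine M.weq_cancel_left _ _ (M.weq_pushout_inl i hi hw) (M.weq_cancel_right _ _ hrw ?_)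
    rw [h₀]
    exact M.weq_id B
  have hk : M'.weq (pushout.inl i i ≫ c) := by
    refine M'.weq_cancel_right _ _ ((hT r).1 ⟨hr, hrw⟩).2 ?_
    rw [h₀]
    exact M'.weq_id B
  have hk' : M'.cof (pushout.inl i i ≫ c) := by
    rw [hcof]
    exact M.cof_comp (M.cof_pushout_inl i hi) hc
  obtain ⟨h, hh⟩ := hfib B' hB' c hc hcw
    (pushout.desc (f := i) (g := i) (s ≫ q) jB (by rw [reassoc_of% hs, fac]))
  have := M'.lift_trivCof_fib _ q hk' hk hq
  have sq : CommSq s (pushout.inl i i ≫ c) q h :=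
    ⟨by rw [Category.assoc, hh, pushout.inl_desc]⟩
  obtain ⟨s', hs'⟩ : ∃ s', s' = pushout.inr i i ≫ c ≫ sq.lift := ⟨_, rfl⟩
  have his' : i ≫ s' = jA := by
    have := sq.fac_left
    rw [Category.assoc] at this
    rw [hs', ← pushout.condition_assoc, this, hs]
  have hs'q : s' ≫ q = jB := by
    rw [hs', Category.assoc, Category.assoc, sq.fac_right, hh, pushout.inr_desc]
  have := M'.lift_trivCof_fib jB q hjB hjB' hq
  have sq' : CommSq s' jB q (𝟙 B') := ⟨by rw [hs'q, Category.comp_id]⟩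
  have hqt : M'.weq (q ≫ sq'.lift) := by
    refine M'.weq_cancel_left jA _ hjA' ?_
    rw [reassoc_of% fac, sq'.fac_left, his']
    exact hjA'
  have hqw : M'.weq q := M'.weq_retract q _ ⟨𝟙 A', 𝟙 A', sq'.lift, q, Category.id_comp _,
    sq'.fac_right, Category.id_comp _, by
      rw [Category.assoc, sq'.fac_right, Category.comp_id, Category.id_comp]⟩ hqt
  refine M'.weq_cancel_right i jB hjB' ?_
  rw [← fac]
  exact M'.weq_comp _ _ hjA' hqw

lemma weq_le {M M' : ModelStructure C} (hcof : M'.cof = M.cof)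
    (hfib : ∀ X, M'.Fibrant X → M.Fibrant X) : M.weq ≤ M'.weq := by
  intro X Y f hf
  obtain ⟨Z, i, p, hi, hp, hw, rfl⟩ := M.fact_cof_trivFib f
  have hp' : M'.fib p ∧ M'.weq p := by
    rw [trivFib_iff, hcof, ← trivFib_iff]
    exact ⟨hp, hw⟩
  exact M'.weq_comp _ _ (weq_of_trivCof hcof hfib hi (M.weq_cancel_right _ _ hw hf)) hp'.2

/-- A model structure is determined by its cofibrations and its fibrant objects. -/
theorem eq_of_cof_eq_of_fibrant_iff {M M' : ModelStructure C} (hcof : M'.cof = M.cof)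
    (hfib : ∀ X, M'.Fibrant X ↔ M.Fibrant X) : M' = M := by
  have hw : M'.weq = M.weq := le_antisymm (weq_le hcof.symm fun X => (hfib X).2)
    (weq_le hcof fun X => (hfib X).1)
  have hf : M'.fib = M.fib := by
    ext X Y p
    rw [fib_iff, fib_iff, hcof, hw]
  cases M
  cases M'
  simp only [ModelStructure.mk.injEq]
  exact ⟨hw, hcof, hf⟩

end ModelStructure

/-- The model structure of `CylinderLifting.exists_modelStructure_over` is characterized by its
cofibrations and fibrant objects. -/
theorem CylinderLifting.exists_unique_modelStructure_over [LocallyPresentable C] {E : Cylinder C}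
    {L An : MorphismProperty C} (H : CylinderLifting E L An)
    (hL : ∃ S : Set (Arrow C), Small.{v} S ∧ L = llp (rlp (ofArrows S)))
    (hAn : ∃ S : Set (Arrow C), Small.{v} S ∧ An = llp (rlp (ofArrows S))) (A : C) :
    ∃ M : ModelStructure (Over A), M.cof = overProp L A ∧
      (∀ X : Over A, M.Fibrant X ↔ IsFib An X.hom) ∧
      ∀ M' : ModelStructure (Over A), M'.cof = overProp L A →
        (∀ X : Over A, M'.Fibrant X ↔ IsFib An X.hom) → M' = M := by
  obtain ⟨M, hM, hM'⟩ := H.exists_modelStructure_over A hL hAn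
  have : HasTerminal (Over A) := Over.mkIdTerminal.hasTerminal
  have : HasPushouts C :=
    (hasColimitsOfSizeShrink.{0, 0, v, v} C).has_colimits_of_shape _
  exact ⟨M, hM, hM', fun M₁ h h' => ModelStructure.eq_of_cof_eq_of_fibrant_iff (h.trans hM.symm)
    fun X => (h' X).trans (hM' X).symm⟩

/-- Theorem 3.2 (relativerighthm): Contravariant and Covariant model structures on the
slice `C/A`. -/
theorem statement_2    {C : Type u} [Category.{v} C] [LocallyPresentable C]
    (L R : MorphismProperty C) (hW : IsCofGenWFS L R)
    (E : Cylinder C) (hE : IsExactCylinder E L)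
    (An : MorphismProperty C) (hAn : IsRightAnodyneClass E L An)
    (Anl : MorphismProperty C) (hAnl : IsLeftAnodyneClass E L Anl)
    (A : C) :
    (∃ M : ModelStructure (Over A),
      M.cof = overProp L A ∧
      (∀ X : Over A, M.Fibrant X ↔ IsFib An X.hom) ∧
      (∀ M' : ModelStructure (Over A), M'.cof = overProp L A →
        (∀ X : Over A, M'.Fibrant X ↔ IsFib An X.hom) → M' = M)) ∧
    (∃ M : ModelStructure (Over A),
      M.cof = overProp L A ∧
      (∀ X : Over A, M.Fibrant X ↔ IsFib Anl X.hom) ∧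
      (∀ M' : ModelStructure (Over A), M'.cof = overProp L A →
        (∀ X : Over A, M'.Fibrant X ↔ IsFib Anl X.hom) → M' = M)) := by
  have : L.RespectsIso := by
    obtain ⟨S, -, rfl⟩ := hW.exists_generating_set
    exact inferInstanceAs (MorphismProperty.rlp (ofArrows S)).llp.RespectsIso
  obtain ⟨S, hS, -, hAnS⟩ := hAn.exists_generating_set
  obtain ⟨T, hT, -, hAnT⟩ := hAnl.exists_generating_set
  exact ⟨(hAn.cylinderLifting hE hW.initial_mem).exists_unique_modelStructure_over
      hW.exists_generating_set ⟨S, hS, hAnS⟩ A,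
    (hAnl.cylinderLifting hE hW.initial_mem).exists_unique_modelStructure_over
      hW.exists_generating_set ⟨T, hT, hAnT⟩ A⟩

end Paper
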